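/- arXiv:2008.01049 — 13 statements merged into one kernel-verified Lean document; each statement's English description precedes it below -/
import Mathlib

section
/- Let d ≥ 0 and consider points α = (α₁, α₋) ∈ ℝ × ℝ^d. Let φ : ℝ × ℝ^d → ℝ be continuous with 0 < φ̲ ≤ φ(x) ≤ Φ̄ for all x, let κ > 0, and let m₀ be a finite Borel measure on ℝ × ℝ^d with total mass M₀ > 0. Set Ψ(x₁, x₋) := ∫₀^{x₁} φ(y, x₋) dy. Let e₀ : ℝ × ℝ^d → ℝ be continuous and nonnegative, and let f₀ : ℝ × ℝ^d → ℝ satisfy f₀(γ, α₋) − f₀(β, α₋) = ∫_β^γ e₀(ζ, α₋) dζ for all β ≤ γ and all α₋. Suppose X : (ℝ × ℝ^d) × [0,∞) → ℝ is such that for each α the map t ↦ X(α,t) is C¹ with X(α,0) = α₁ and ∂ₜX(α,t) = f₀(α) − κ·∫ Ψ(X(α,t) − X(γ,t), α₋ − γ₋) dm₀(γ). Then for every α₋ ∈ ℝ^d, all reals β ≤ γ, and all t ≥ 0: X(γ, α₋, t) − X(β, α₋, t) ≥ (γ − β)·exp(−κ M₀ Φ̄ t). -/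
open MeasureTheory

/-- `Ψ(x₁, xm) = ∫₀^{x₁} φ(y, xm) dy`, the antiderivative of the kernel in the first variable. -/
noncomputable def Psi (d : ℕ) (φ : ℝ × (Fin d → ℝ) → ℝ) (x₁ : ℝ) (xm : Fin d → ℝ) : ℝ :=
  ∫ y in (0:ℝ)..x₁, φ (y, xm)

lemma Psi_sub_bounds {d : ℕ} {φ : ℝ × (Fin d → ℝ) → ℝ} (hφc : Continuous φ)
    {φl φu : ℝ} (hφbd : ∀ x, φl ≤ φ x ∧ φ x ≤ φu) (xm : Fin d → ℝ) {x y : ℝ} (hxy : x ≤ y) :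
    φl * (y - x) ≤ Psi d φ y xm - Psi d φ x xm ∧
      Psi d φ y xm - Psi d φ x xm ≤ φu * (y - x) := by
  have hc : Continuous fun z : ℝ => φ (z, xm) := by fun_prop
  have hi : ∀ a b : ℝ, IntervalIntegrable (fun z : ℝ => φ (z, xm)) volume a b :=
    fun a b => hc.intervalIntegrable a b
  have he : Psi d φ y xm - Psi d φ x xm = ∫ z in x..y, φ (z, xm) :=
    intervalIntegral.integral_interval_sub_left (hi 0 y) (hi 0 x)
  rw [he]
  have hk : ∀ c : ℝ, c * (y - x) = ∫ _ in x..y, c := by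
    intro c
    rw [intervalIntegral.integral_const, smul_eq_mul, mul_comm]
  constructor
  · rw [hk φl]
    exact intervalIntegral.integral_mono_on hxy intervalIntegrable_const (hi x y)
      (fun z _ => (hφbd _).1)
  · rw [hk φu]
    exact intervalIntegral.integral_mono_on hxy (hi x y) intervalIntegrable_const
      (fun z _ => (hφbd _).2)

lemma Psi_continuous {d : ℕ} {φ : ℝ × (Fin d → ℝ) → ℝ} (hφc : Continuous φ) :
    Continuous fun p : ℝ × (Fin d → ℝ) => Psi d φ p.1 p.2 := by
  unfold Psi
  exact intervalIntegral.continuous_parametric_intervalIntegral_of_continuous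
    (f := fun (p : ℝ × (Fin d → ℝ)) (y : ℝ) => φ (y, p.2))
    (by unfold Function.uncurry; fun_prop) continuous_fst

lemma Psi_integrable_transfer {d : ℕ} {φ : ℝ × (Fin d → ℝ) → ℝ} (hφc : Continuous φ)
    {φl φu : ℝ} (hφl : 0 < φl) (hφbd : ∀ x, φl ≤ φ x ∧ φ x ≤ φu)
    (m₀ : Measure (ℝ × (Fin d → ℝ))) [IsFiniteMeasure m₀]
    (Y : ℝ × (Fin d → ℝ) → ℝ) (αm : Fin d → ℝ) (a b : ℝ)
    (h : Integrable (fun η => Psi d φ (a - Y η) (αm - η.2)) m₀) :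
    Integrable (fun η => Psi d φ (b - Y η) (αm - η.2)) m₀ := by
  have hPc := Psi_continuous hφc
  have hGc : Continuous fun p : ℝ × (Fin d → ℝ) => (Psi d φ p.1 p.2, p.2) :=
    hPc.prodMk continuous_snd
  have hGi : Function.Injective fun p : ℝ × (Fin d → ℝ) => (Psi d φ p.1 p.2, p.2) := by
    rintro ⟨x, u⟩ ⟨y, v⟩ hxy
    simp only [Prod.mk.injEq] at hxy
    obtain ⟨h1, rfl⟩ := hxy
    have : x = y := by
      rcases le_total x y with hl | hl
      · have := (Psi_sub_bounds hφc hφbd u hl).1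
        nlinarith
      · have := (Psi_sub_bounds hφc hφbd u hl).1
        nlinarith
    rw [this]
  have hG := hGc.measurableEmbedding hGi
  have h2 : AEMeasurable (fun η : ℝ × (Fin d → ℝ) => αm - η.2) m₀ :=
    (by fun_prop : Measurable fun η : ℝ × (Fin d → ℝ) => αm - η.2).aemeasurable
  have h3 : AEMeasurable (fun η : ℝ × (Fin d → ℝ) => (a - Y η, αm - η.2)) m₀ := by
    refine (hG.aemeasurable_comp_iff).1 ?_
    exact h.aestronglyMeasurable.aemeasurable.prodMk h2
  have h4 : AEMeasurable (fun η : ℝ × (Fin d → ℝ) => b - Y η) m₀ := by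
    have := h3.fst.const_add (b - a)
    refine this.congr (Filter.Eventually.of_forall fun η => ?_)
    simp
  have h5 : AEMeasurable (fun η => Psi d φ (b - Y η) (αm - η.2)) m₀ :=
    hPc.measurable.comp_aemeasurable (h4.prodMk h2)
  have h6 : Integrable (fun η => Psi d φ (b - Y η) (αm - η.2)
      - Psi d φ (a - Y η) (αm - η.2)) m₀ := by
    refine Integrable.of_bound
      (h5.sub h.aestronglyMeasurable.aemeasurable).aestronglyMeasurable (φu * |b - a|)
      (Filter.Eventually.of_forall fun η => ?_)
    rw [Real.norm_eq_abs]
    rcases le_total a b with hl | hl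
    · have := Psi_sub_bounds hφc hφbd (αm - η.2) (sub_le_sub_right hl (Y η))
      rw [abs_of_nonneg (sub_nonneg.2 hl), abs_of_nonneg]
      · linarith [this.2]
      · nlinarith [this.1]
    · have := Psi_sub_bounds hφc hφbd (αm - η.2) (sub_le_sub_right hl (Y η))
      rw [abs_of_nonpos (sub_nonpos.2 hl), abs_of_nonpos]
      · linarith [this.2]
      · nlinarith [this.1]
  refine (h6.add h).congr (Filter.Eventually.of_forall fun η => ?_)
  simp

lemma Psi_integral_diff {d : ℕ} {φ : ℝ × (Fin d → ℝ) → ℝ} (hφc : Continuous φ)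
    {φl φu : ℝ} (hφl : 0 < φl) (hφbd : ∀ x, φl ≤ φ x ∧ φ x ≤ φu)
    (m₀ : Measure (ℝ × (Fin d → ℝ))) [IsFiniteMeasure m₀]
    (M₀ : ℝ) (hM₀ : 0 < M₀) (hmass : m₀ Set.univ = ENNReal.ofReal M₀)
    (Y : ℝ × (Fin d → ℝ) → ℝ) (αm : Fin d → ℝ) (a b : ℝ) :
    (∫ η, Psi d φ (b - Y η) (αm - η.2) ∂m₀) - (∫ η, Psi d φ (a - Y η) (αm - η.2) ∂m₀)
      ≤ M₀ * φu * max (b - a) 0 := by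
  have hφu : 0 < φu := lt_of_lt_of_le hφl ((hφbd 0).1.trans (hφbd 0).2)
  by_cases h : Integrable (fun η => Psi d φ (a - Y η) (αm - η.2)) m₀
  · have h' := Psi_integrable_transfer hφc hφl hφbd m₀ Y αm a b h
    rw [← integral_sub h' h]
    have hc : M₀ * φu * max (b - a) 0 = ∫ _, φu * max (b - a) 0 ∂m₀ := by
      rw [integral_const, smul_eq_mul, Measure.real, hmass, ENNReal.toReal_ofReal hM₀.le]
      ring
    rw [hc]
    refine integral_mono (h'.sub h) (integrable_const _) fun η => ?_
    dsimp only
    rcases le_total a b with hl | hl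
    · have := Psi_sub_bounds hφc hφbd (αm - η.2) (sub_le_sub_right hl (Y η))
      rw [max_eq_left (sub_nonneg.2 hl)]
      linarith [this.2]
    · have := Psi_sub_bounds hφc hφbd (αm - η.2) (sub_le_sub_right hl (Y η))
      rw [max_eq_right (sub_nonpos.2 hl)]
      nlinarith [this.1]
  · have h' : ¬ Integrable (fun η => Psi d φ (b - Y η) (αm - η.2)) m₀ := fun hb =>
      h (Psi_integrable_transfer hφc hφl hφbd m₀ Y αm b a hb)
    rw [integral_undef h, integral_undef h']
    have : 0 ≤ max (b - a) 0 := le_max_right _ _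
    simp only [sub_zero]
    positivity

/-- The quantitative bi-Lipschitz lower bound (e:Oeuni): under the critical threshold
condition `e₀ ≥ 0`, trajectories on a common slice separate at worst like
`(γ − β)·exp(−κ M₀ ‖φ‖_∞ t)`. -/
theorem stmt_2 (d : ℕ) (φ : ℝ × (Fin d → ℝ) → ℝ) (hφc : Continuous φ)
    (φl φu : ℝ) (hφl : 0 < φl) (hφbd : ∀ x, φl ≤ φ x ∧ φ x ≤ φu)
    (κ : ℝ) (hκ : 0 < κ)
    (m₀ : Measure (ℝ × (Fin d → ℝ))) [IsFiniteMeasure m₀]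
    (M₀ : ℝ) (hM₀ : 0 < M₀) (hmass : m₀ Set.univ = ENNReal.ofReal M₀)
    (e₀ : ℝ × (Fin d → ℝ) → ℝ) (he₀c : Continuous e₀) (he₀ : ∀ α, 0 ≤ e₀ α)
    (f₀ : ℝ × (Fin d → ℝ) → ℝ)
    (hf₀ : ∀ (αm : Fin d → ℝ) (β γ : ℝ), β ≤ γ →
      f₀ (γ, αm) - f₀ (β, αm) = ∫ ζ in β..γ, e₀ (ζ, αm))
    (X : (ℝ × (Fin d → ℝ)) → ℝ → ℝ)
    (hX0 : ∀ α, X α 0 = α.1)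
    (hXderiv : ∀ α, ∀ t ≥ (0:ℝ), HasDerivWithinAt (X α)
      (f₀ α - κ * ∫ γ, Psi d φ (X α t - X γ t) (α.2 - γ.2) ∂m₀) (Set.Ici 0) t) :
    ∀ (αm : Fin d → ℝ) (β γ : ℝ), β ≤ γ → ∀ t ≥ (0:ℝ),
      (γ - β) * Real.exp (-κ * M₀ * φu * t) ≤ X (γ, αm) t - X (β, αm) t := by
  intro αm β γ hβγ t ht
  have hφu : 0 < φu := lt_of_lt_of_le hφl ((hφbd 0).1.trans (hφbd 0).2)
  obtain ⟨K, hK⟩ : ∃ K, K = κ * M₀ * φu := ⟨_, rfl⟩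
  have hKpos : 0 < K := by rw [hK]; positivity
  have hKe : -κ * M₀ * φu * t = -K * t := by rw [hK]; ring
  rw [hKe]
  have hf : 0 ≤ f₀ (γ, αm) - f₀ (β, αm) := by
    rw [hf₀ αm β γ hβγ]
    exact intervalIntegral.integral_nonneg hβγ fun z _ => he₀ _
  have key : ∀ ε > (0:ℝ), -(X (γ, αm) t - X (β, αm) t) ≤
      -((γ - β) * Real.exp (-K * t)) + ε * (1 + t) := by
    intro ε hε
    have hd : ∀ s ≥ (0:ℝ), HasDerivWithinAt (fun s => -(X (γ, αm) s - X (β, αm) s)) _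
        (Set.Ici 0) s := fun s hs =>
      ((hXderiv (γ, αm) s hs).sub (hXderiv (β, αm) s hs)).neg
    refine image_le_of_deriv_right_lt_deriv_boundary (a := 0) (b := t)
      (f := fun s => -(X (γ, αm) s - X (β, αm) s))
      (B := fun s => -((γ - β) * Real.exp (-K * s)) + ε * (1 + s))
      (B' := fun s => K * ((γ - β) * Real.exp (-K * s)) + ε)
      (fun s hs => ((hd s hs.1).continuousWithinAt).mono Set.Icc_subset_Ici_self)
      (fun s hs => (hd s hs.1).mono (Set.Ici_subset_Ici.2 hs.1)) ?_ ?_ ?_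
      (Set.right_mem_Icc.2 ht)
    · simp [hX0]
      linarith
    · intro s
      have h1 : HasDerivAt (fun s : ℝ => -K * s) (-K) s := by
        simpa using (hasDerivAt_id s).const_mul (-K)
      have h2 := ((h1.exp.const_mul (γ - β)).neg).add
        (((hasDerivAt_id s).const_add 1).const_mul ε)
      refine h2.congr_deriv ?_
      ring
    · intro s hs heq
      dsimp only at heq ⊢
      have hI := Psi_integral_diff hφc hφl hφbd m₀ M₀ hM₀ hmass (fun η => X η s) αm
        (X (β, αm) s) (X (γ, αm) s)
      have hE : 0 ≤ (γ - β) * Real.exp (-K * s) :=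
        mul_nonneg (sub_nonneg.2 hβγ) (Real.exp_pos _).le
      have hs0 : 0 ≤ ε * (1 + s) := mul_nonneg hε.le (by linarith [hs.1])
      have hm : max (X (γ, αm) s - X (β, αm) s) 0 ≤ (γ - β) * Real.exp (-K * s) :=
        max_le (by linarith) hE
      have h1 := mul_le_mul_of_nonneg_left hI hκ.le
      have h2 := mul_le_mul_of_nonneg_left hm hKpos.le
      have h3 : κ * (M₀ * φu * max (X (γ, αm) s - X (β, αm) s) 0)
        = K * max (X (γ, αm) s - X (β, αm) s) 0 := by rw [hK]; ring
      rw [h3, mul_sub] at h1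
      linarith
  have h1t : 0 < 1 + t := by linarith
  refine le_of_forall_pos_le_add fun δ hδ => ?_
  have := key (δ / (1 + t)) (by positivity)
  rw [div_mul_cancel₀ _ h1t.ne'] at this
  linarith
end

section
/- Let d ≥ 0, let φ : ℝ × ℝ^d → ℝ be bounded and Lipschitz continuous, let κ > 0, let m₀ be a finite Borel measure on ℝ × ℝ^d with compact support, let Ω ⊆ ℝ × ℝ^d be a compact set containing the support of m₀, and let f₀ : Ω → ℝ be continuous. Set Ψ(x₁, x₋) := ∫₀^{x₁} φ(y, x₋) dy. Then there exists exactly one continuous function X : Ω × [0,∞) → ℝ such that for every α = (α₁, α₋) ∈ Ω the map t ↦ X(α,t) is continuously differentiable, X(α,0) = α₁, and ∂ₜX(α,t) = f₀(α) − κ·∫_Ω Ψ(X(α,t) − X(γ,t), α₋ − γ₋) dm₀(γ) for all t ≥ 0. -/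
open MeasureTheory

theorem aux_uniq {E : Type*} [NormedAddCommGroup E] [NormedSpace ℝ E]
    {K : NNReal} {F : E → E} (hF : LipschitzWith K F) {T : ℝ} {f g : ℝ → E}
    (hf : ∀ t ∈ Set.Icc 0 T, HasDerivWithinAt f (F (f t)) (Set.Icc 0 T) t)
    (hg : ∀ t ∈ Set.Icc 0 T, HasDerivWithinAt g (F (g t)) (Set.Icc 0 T) t)
    (h0 : f 0 = g 0) : Set.EqOn f g (Set.Icc 0 T) := by
  refine ODE_solution_unique (v := fun _ => F) (K := K) (fun _ => hF)
    (fun t ht => (hf t ht).continuousWithinAt) (fun t ht => ?_)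
    (fun t ht => (hg t ht).continuousWithinAt) (fun t ht => ?_) h0
  · exact (hf t (Set.Ico_subset_Icc_self ht)).mono_of_mem_nhdsWithin (Icc_mem_nhdsGE_of_mem ht)
  · exact (hg t (Set.Ico_subset_Icc_self ht)).mono_of_mem_nhdsWithin (Icc_mem_nhdsGE_of_mem ht)

theorem aux_local {E : Type*} [NormedAddCommGroup E] [NormedSpace ℝ E] [CompleteSpace E]
    {K : NNReal} {F : E → E} (hF : LipschitzWith K F) (x₀ : E) (s : ℝ) :
    ∃ f : ℝ → E, f s = x₀ ∧ ∀ t ∈ Set.Icc s (s + 1 / (1 + K)),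
      HasDerivWithinAt f (F (f t)) (Set.Icc s (s + 1 / (1 + K))) t := by
  have hp : (0:ℝ) < 1 / (1 + K) := by positivity
  set a : NNReal := ‖F x₀‖₊ + 1 with ha
  have h : IsPicardLindelof (fun _ => F) (tmin := s) (tmax := s + 1 / (1 + K))
      ⟨s, by constructor <;> linarith⟩ x₀ a 0 ((1 + K) * a) K := by
    refine IsPicardLindelof.of_time_independent ?_ hF.lipschitzOnWith ?_
    · intro x hx
      have h1 := hF.dist_le_mul x x₀
      have h2 : dist x x₀ ≤ a := hx
      have h3 : ‖F x‖ ≤ ‖F x₀‖ + dist (F x) (F x₀) := by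
        rw [dist_eq_norm]; exact norm_le_norm_add_norm_sub' _ _
      have h4 : (K:ℝ) * dist x x₀ ≤ K * a := by gcongr
      have h5 : (a:ℝ) = ‖F x₀‖ + 1 := by simp [ha]
      push_cast
      nlinarith
    · have : max (s + 1 / (1 + (K:ℝ)) - s) (s - s) = 1 / (1 + K) := by
        rw [max_eq_left] <;> linarith
      simp only [this]
      push_cast
      have : (1 + (K:ℝ)) ≠ 0 := by positivity
      field_simp
      simp
  exact h.exists_eq_forall_mem_Icc_hasDerivWithinAt₀

theorem aux_steps {E : Type*} [NormedAddCommGroup E] [NormedSpace ℝ E] [CompleteSpace E]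
    {K : NNReal} {F : E → E} (hF : LipschitzWith K F) (x₀ : E) (n : ℕ) :
    ∃ f : ℝ → E, f 0 = x₀ ∧ ∀ t ∈ Set.Icc 0 (n * (1 / (1 + K) : ℝ)),
      HasDerivWithinAt f (F (f t)) (Set.Icc 0 (n * (1 / (1 + K) : ℝ))) t := by
  have hp : (0:ℝ) < 1 / (1 + K) := by positivity
  induction n with
  | zero =>
    obtain ⟨f, h0, h⟩ := aux_local hF x₀ 0
    refine ⟨f, h0, fun t ht => (h t ?_).mono ?_⟩
    · simp at ht; subst ht; constructor <;> linarith
    · simp; positivity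
  | succ n ih =>
    obtain ⟨f, f0, hf⟩ := ih
    set T : ℝ := n * (1 / (1 + K)) with hT
    have hT0 : 0 ≤ T := by positivity
    obtain ⟨g, g0, hg⟩ := aux_local hF (f T) T
    have e : ((n + 1 : ℕ) : ℝ) * (1 / (1 + K)) = T + 1 / (1 + K) := by rw [hT]; push_cast; ring
    rw [e]
    generalize (1 / (1 + K) : ℝ) = ε at *
    have hu : Set.Icc 0 (T + ε) = Set.Icc 0 T ∪ Set.Icc T (T + ε) :=
      (Set.Icc_union_Icc_eq_Icc hT0 (by linarith)).symm
    set q : ℝ → E := fun t => if t ≤ T then f t else g t with hq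
    have q1 : ∀ t ∈ Set.Icc 0 T, q t = f t := fun t ht => if_pos ht.2
    have q2 : ∀ t ∈ Set.Icc T (T + ε), q t = g t := by
      intro t ht
      rcases ht.1.eq_or_lt with h | h
      · subst h; simp [hq, g0]
      · simp [hq, not_le.2 h]
    refine ⟨q, by simp [hq, hT0, f0], fun t ht => ?_⟩
    rw [hu]
    apply HasDerivWithinAt.union
    · by_cases h : t ∈ Set.Icc 0 T
      · rw [q1 t h]; exact (hf t h).congr_of_mem q1 h
      · exact HasFDerivWithinAt.of_notMem_closure (by rwa [closure_Icc])
    · by_cases h : t ∈ Set.Icc T (T + ε)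
      · rw [q2 t h]; exact (hg t h).congr_of_mem q2 h
      · exact HasFDerivWithinAt.of_notMem_closure (by rwa [closure_Icc])

theorem aux_global {E : Type*} [NormedAddCommGroup E] [NormedSpace ℝ E] [CompleteSpace E]
    {K : NNReal} {F : E → E} (hF : LipschitzWith K F) (x₀ : E) :
    ∃ f : ℝ → E, f 0 = x₀ ∧ ∀ t ≥ (0:ℝ), HasDerivWithinAt f (F (f t)) (Set.Ici 0) t := by
  choose f f0 hf using aux_steps hF x₀
  have hp : (0:ℝ) < 1 / (1 + K) := by positivity
  generalize (1 / (1 + K) : ℝ) = ε at *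
  have key : ∀ m n : ℕ, m ≤ n → Set.EqOn (f m) (f n) (Set.Icc 0 (m * ε)) := by
    intro m n hmn
    have hs : Set.Icc (0:ℝ) (m * ε) ⊆ Set.Icc 0 (n * ε) := by
      apply Set.Icc_subset_Icc_right; gcongr
    exact aux_uniq hF (hf m) (fun t ht => (hf n t (hs ht)).mono hs) (by rw [f0, f0])
  have hc : ∀ t : ℝ, t ≤ (⌈t / ε⌉₊ : ℝ) * ε := fun t => by
    rw [← div_le_iff₀ hp]; exact Nat.le_ceil _
  have key2 : ∀ n : ℕ, ∀ t ∈ Set.Icc 0 (n * ε), f ⌈t / ε⌉₊ t = f n t := by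
    intro n t ht
    refine key _ n ?_ ⟨ht.1, hc t⟩
    rw [Nat.ceil_le, div_le_iff₀ hp]; exact ht.2
  refine ⟨fun t => f ⌈t / ε⌉₊ t, by simp [f0], fun t ht => ?_⟩
  set N := ⌈t / ε⌉₊ + 1 with hN
  have htN : t < N * ε := by
    have := hc t
    rw [hN]; push_cast; linarith
  have hmem : t ∈ Set.Icc 0 (N * ε) := ⟨ht, htN.le⟩
  have h := (hf N t hmem).congr_of_mem (key2 N) hmem
  rw [← key2 N t hmem] at h
  refine h.mono_of_mem_nhdsWithin ?_
  rw [← Set.Ici_inter_Iic]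
  exact Filter.inter_mem self_mem_nhdsWithin (mem_nhdsWithin_of_mem_nhds (Iic_mem_nhds htN))

theorem aux_psi_cont (d : ℕ) (φ : ℝ × (Fin d → ℝ) → ℝ) (hφ : Continuous φ) :
    Continuous (fun p : ℝ × (Fin d → ℝ) => Psi d φ p.1 p.2) := by
  unfold Psi
  apply intervalIntegral.continuous_parametric_intervalIntegral_of_continuous
  · simp only [Function.uncurry_def]; fun_prop
  · fun_prop

theorem aux_psi_lip (d : ℕ) (φ : ℝ × (Fin d → ℝ) → ℝ) (hφ : Continuous φ)
    (C : ℝ) (hC : ∀ x, |φ x| ≤ C) (a b : ℝ) (y : Fin d → ℝ) :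
    |Psi d φ a y - Psi d φ b y| ≤ C * |a - b| := by
  unfold Psi
  have hi : ∀ u v : ℝ, IntervalIntegrable (fun s => φ (s, y)) volume u v := fun u v =>
    Continuous.intervalIntegrable (by fun_prop) _ _
  rw [intervalIntegral.integral_interval_sub_left (hi _ _) (hi _ _)]
  exact intervalIntegral.norm_integral_le_of_norm_le_const (f := fun s => φ (s, y)) (C := C)
    (fun x _ => hC _)

theorem aux_field (d : ℕ) (φ : ℝ × (Fin d → ℝ) → ℝ)
    (Cφ : ℝ) (hφbd : ∀ x, |φ x| ≤ Cφ) (hφ : Continuous φ)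
    (κ : ℝ) (hκ : 0 < κ)
    (m₀ : Measure (ℝ × (Fin d → ℝ))) [IsFiniteMeasure m₀]
    (Ω : Set (ℝ × (Fin d → ℝ))) (hΩ : IsCompact Ω) [CompactSpace Ω]
    (f₀ : ℝ × (Fin d → ℝ) → ℝ) (hf₀ : ContinuousOn f₀ Ω) :
    ∃ (F : C(Ω, ℝ) → C(Ω, ℝ)) (L : NNReal), LipschitzWith L F ∧
      ∀ (u : C(Ω, ℝ)) (v : ℝ × (Fin d → ℝ) → ℝ), (∀ α : Ω, u α = v α) →
        ∀ α : Ω, F u α = f₀ α - κ * ∫ γ in Ω, Psi d φ (v α - v γ) (α.1.2 - γ.2) ∂m₀ := by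
  have hPc := aux_psi_cont d φ hφ
  set μ : Measure Ω := m₀.comap Subtype.val with hμ
  have hC : 0 ≤ Cφ := (abs_nonneg _).trans (hφbd 0)
  have hj : ∀ u : C(Ω, ℝ), Continuous
      (fun p : Ω × Ω => Psi d φ (u p.1 - u p.2) (p.1.1.2 - p.2.1.2)) := fun u =>
    hPc.comp (f := fun p : Ω × Ω => (u p.1 - u p.2, p.1.1.2 - p.2.1.2)) (by fun_prop)
  have hc : ∀ u : C(Ω, ℝ), Continuous
      (fun α : Ω => f₀ α - κ * ∫ γ : Ω, Psi d φ (u α - u γ) (α.1.2 - γ.1.2) ∂μ) := by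
    intro u
    have h1 : Continuous fun α : Ω => f₀ α := continuousOn_iff_continuous_domRestrict.1 hf₀
    have h2 := continuous_parametric_integral_of_continuous (μ := μ)
      (f := fun α γ : Ω => Psi d φ (u α - u γ) (α.1.2 - γ.1.2)) (hj u) isCompact_univ
    simp only [Measure.restrict_univ] at h2
    exact h1.sub (continuous_const.mul h2)
  have hint : ∀ (u : C(Ω, ℝ)) (α : Ω),
      Integrable (fun γ : Ω => Psi d φ (u α - u γ) (α.1.2 - γ.1.2)) μ := by
    intro u α
    have : Continuous (fun γ : Ω => Psi d φ (u α - u γ) (α.1.2 - γ.1.2)) :=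
      (hj u).comp (f := fun γ : Ω => (α, γ)) (by fun_prop)
    exact this.integrable_of_hasCompactSupport (HasCompactSupport.of_compactSpace _)
  refine ⟨fun u => ⟨_, hc u⟩, (κ * (Cφ * 2 * μ.real Set.univ)).toNNReal, ?_, ?_⟩
  · refine LipschitzWith.of_dist_le_mul fun u v => ?_
    rw [Real.coe_toNNReal _ (by positivity)]
    rw [ContinuousMap.dist_le (by positivity)]
    intro α
    simp only [ContinuousMap.coe_mk, Real.dist_eq]
    rw [sub_sub_sub_cancel_left, ← mul_sub, ← integral_sub (hint _ _) (hint _ _), abs_mul,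
      abs_of_pos hκ, mul_assoc]
    gcongr
    have := norm_integral_le_of_norm_le_const (μ := μ) (C := Cφ * (2 * dist u v))
      (f := fun γ : Ω => Psi d φ (v α - v γ) (α.1.2 - γ.1.2)
        - Psi d φ (u α - u γ) (α.1.2 - γ.1.2)) (Filter.Eventually.of_forall fun γ => ?_)
    · rw [Real.norm_eq_abs] at this
      linarith
    · refine (aux_psi_lip d φ hφ Cφ hφbd _ _ _).trans ?_
      gcongr
      have h1 := ContinuousMap.dist_apply_le_dist (f := u) (g := v) α
      have h2 := ContinuousMap.dist_apply_le_dist (f := u) (g := v) γ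
      rw [Real.dist_eq, abs_le] at h1 h2
      rw [abs_le]
      constructor <;> linarith
  · intro u v huv α
    simp only [ContinuousMap.coe_mk]
    rw [← integral_subtype_comap hΩ.measurableSet]
    simp only [huv]
    rfl

/-- Global existence and uniqueness for the reduced Lagrangian formulation (e:Xdot) of the
unidirectional Euler Alignment system with measure-valued initial density: there is exactly
one continuous `X : Ω × [0,∞) → ℝ` solving the ODE with `X(α,0) = α₁`. -/
theorem stmt_3 (d : ℕ) (φ : ℝ × (Fin d → ℝ) → ℝ)
    (Cφ : ℝ) (hφbd : ∀ x, |φ x| ≤ Cφ) (K : NNReal) (hφlip : LipschitzWith K φ)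
    (κ : ℝ) (hκ : 0 < κ)
    (m₀ : Measure (ℝ × (Fin d → ℝ))) [IsFiniteMeasure m₀]
    (Ω : Set (ℝ × (Fin d → ℝ))) (hΩ : IsCompact Ω)
    (hsupp : m₀ Ωᶜ = 0)
    (f₀ : ℝ × (Fin d → ℝ) → ℝ) (hf₀ : ContinuousOn f₀ Ω) :
    ∃ X : (ℝ × (Fin d → ℝ)) → ℝ → ℝ,
      (ContinuousOn (fun p : (ℝ × (Fin d → ℝ)) × ℝ => X p.1 p.2) (Ω ×ˢ Set.Ici 0) ∧
        (∀ α ∈ Ω, X α 0 = α.1) ∧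
        ∀ α ∈ Ω, ∀ t ≥ (0:ℝ), HasDerivWithinAt (X α)
          (f₀ α - κ * ∫ γ in Ω, Psi d φ (X α t - X γ t) (α.2 - γ.2) ∂m₀) (Set.Ici 0) t) ∧
      ∀ Y : (ℝ × (Fin d → ℝ)) → ℝ → ℝ,
        (ContinuousOn (fun p : (ℝ × (Fin d → ℝ)) × ℝ => Y p.1 p.2) (Ω ×ˢ Set.Ici 0) ∧
          (∀ α ∈ Ω, Y α 0 = α.1) ∧
          ∀ α ∈ Ω, ∀ t ≥ (0:ℝ), HasDerivWithinAt (Y α)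
            (f₀ α - κ * ∫ γ in Ω, Psi d φ (Y α t - Y γ t) (α.2 - γ.2) ∂m₀) (Set.Ici 0) t) →
        ∀ α ∈ Ω, ∀ t ≥ (0:ℝ), Y α t = X α t := by
  have : CompactSpace Ω := isCompact_iff_compactSpace.1 hΩ
  obtain ⟨F, L, hF, hFe⟩ := aux_field d φ Cφ hφbd hφlip.continuous κ hκ m₀ Ω hΩ f₀ hf₀
  obtain ⟨Γ, Γ0, hΓ⟩ := aux_global hF ⟨fun α : Ω => α.1.1, by fun_prop⟩
  have hX : ∀ (t : ℝ) (α : Ω), Γ t α =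
      (fun (β : ℝ × (Fin d → ℝ)) => open Classical in if h : β ∈ Ω then Γ t ⟨β, h⟩ else 0) α := by
    intro t α; simp
  refine ⟨fun α t => open Classical in if h : α ∈ Ω then Γ t ⟨α, h⟩ else 0, ⟨?_, ?_, ?_⟩, ?_⟩
  · have hcΓ : ContinuousOn Γ (Set.Ici 0) := fun t ht => (hΓ t ht).continuousWithinAt
    rw [continuousOn_iff_continuous_domRestrict] at hcΓ ⊢
    have : Continuous fun p : (Ω ×ˢ Set.Ici (0:ℝ) : Set ((ℝ × (Fin d → ℝ)) × ℝ)) =>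
        (Set.Ici (0:ℝ)).domRestrict Γ ⟨p.1.2, p.2.2⟩ ⟨p.1.1, p.2.1⟩ := by
      have h1 : Continuous fun p : (Ω ×ˢ Set.Ici (0:ℝ) : Set ((ℝ × (Fin d → ℝ)) × ℝ)) =>
        (Set.Ici (0:ℝ)).domRestrict Γ ⟨p.1.2, p.2.2⟩ := hcΓ.comp (by fun_prop)
      fun_prop
    refine this.congr fun p => ?_
    have : p.1.1 ∈ Ω := p.2.1
    simp [this]
  · intro α hα
    simp [hα, Γ0]
  · intro α hα t ht
    have h := ((ContinuousMap.evalCLM ℝ (⟨α, hα⟩ : Ω)).hasFDerivAt.comp_hasDerivWithinAt t (hΓ t ht))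
    have e := hFe (Γ t) (fun (β : ℝ × (Fin d → ℝ)) =>
      open Classical in if h : β ∈ Ω then Γ t ⟨β, h⟩ else 0) (hX t) ⟨α, hα⟩
    refine (h.congr_deriv (f' := _) e).congr (fun s _ => ?_) ?_
    · simp [hα]
    · simp [hα]
  · rintro Y ⟨Yc, Y0, hY⟩ α hα t ht
    rw [continuousOn_iff_continuous_domRestrict] at Yc
    have hyc : Continuous fun p : ℝ × Ω => Y p.2 (max p.1 0) :=
      Yc.comp (f := fun p : ℝ × Ω => (⟨(p.2.1, max p.1 0), p.2.2, Set.mem_Ici.2 (le_max_right _ _)⟩ :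
        (Ω ×ˢ Set.Ici (0:ℝ) : Set ((ℝ × (Fin d → ℝ)) × ℝ)))) (by fun_prop)
    let y : C(ℝ, C(Ω, ℝ)) := ContinuousMap.curry ⟨_, hyc⟩
    have hye : ∀ s ≥ (0:ℝ), ∀ β : Ω, y s β = Y β s := by
      intro s hs β
      change Y β (max s 0) = _
      rw [max_eq_left hs]
    have hFy : Continuous fun s => F (y s) := hF.continuous.comp y.continuous
    let z : ℝ → C(Ω, ℝ) := fun s => y 0 + ∫ r in (0:ℝ)..s, F (y r)
    have hz : ∀ s, HasDerivAt z (F (y s)) s := fun s =>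
      (hFy.integral_hasStrictDerivAt 0 s).hasDerivAt.const_add _
    have hyz : ∀ s ≥ (0:ℝ), y s = z s := by
      intro s hs
      ext β
      rw [hye s hs]
      have hd : ∀ r, HasDerivAt (fun r => z r β) (F (y r) β) r := by
        intro r
        have h := (ContinuousMap.evalCLM ℝ β : C(Ω, ℝ) →L[ℝ] ℝ).hasFDerivAt.comp_hasDerivAt r (hz r)
        exact h
      refine eq_of_has_deriv_right_eq (a := 0) (b := s) (f := Y β) (g := fun r => z r β)
        (f' := fun r => F (y r) β) (fun r hr => ?_) (fun r _ => (hd r).hasDerivWithinAt)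
        (fun r hr => ((hY β β.2 r hr.1).continuousWithinAt).mono Set.Icc_subset_Ici_self)
        (fun r _ => (hd r).continuousAt.continuousWithinAt) ?_ s ⟨hs, le_rfl⟩
      · rw [hFe (y r) (fun β => Y β r) (hye r hr.1)]
        exact (hY β β.2 r hr.1).mono (Set.Ici_subset_Ici.2 hr.1)
      · simp [z, hye]
    have hy : ∀ s ∈ Set.Icc 0 t, HasDerivWithinAt y (F (y s)) (Set.Icc 0 t) s := fun s hs =>
      (hz s).hasDerivWithinAt.congr_of_mem (fun r hr => hyz r hr.1) hs
    have := aux_uniq hF hy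
      (fun s hs => (hΓ s hs.1).mono Set.Icc_subset_Ici_self)
      (by rw [Γ0]; ext β; rw [hye 0 le_rfl, Y0 β β.2]; rfl) ⟨ht, le_rfl⟩
    simp only [hα, dif_pos]
    rw [← this, hye t ht]
end

section
/- Let e₀ : ℝ → ℝ be continuous and nonnegative, and suppose F : ℝ → ℝ satisfies the two-sided bound: there are constants 0 < a ≤ b such that a·∫_β^γ e₀(ζ) dζ ≤ F(γ) − F(β) ≤ b·∫_β^γ e₀(ζ) dζ for all reals β ≤ γ. Then for every bounded Lebesgue-measurable set E ⊆ ℝ, a·∫_E e₀ dλ ≤ λ(F(E)) ≤ b·∫_E e₀ dλ, where λ denotes one-dimensional Lebesgue (outer) measure and F(E) is the image of E under F. In particular, λ(F(Z)) = 0 for the zero set Z := {α ∈ ℝ : e₀(α) = 0}. -/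
open MeasureTheory

/-- Proposition 4.2 (p:Xm): the one-dimensional image-measure estimate.  If the increments of
`F` are comparable to integrals of the nonnegative continuous function `e₀`, then for every
bounded measurable set `E`, `a·∫_E e₀ ≤ λ(F(E)) ≤ b·∫_E e₀`; in particular the image of the
zero set `Z` of `e₀` is Lebesgue-null. -/
theorem stmt_4 (e₀ : ℝ → ℝ) (he₀c : Continuous e₀) (he₀ : ∀ α, 0 ≤ e₀ α)
    (F : ℝ → ℝ) (a b : ℝ) (ha : 0 < a) (hab : a ≤ b)
    (hF : ∀ β γ : ℝ, β ≤ γ →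
      a * ∫ ζ in β..γ, e₀ ζ ≤ F γ - F β ∧ F γ - F β ≤ b * ∫ ζ in β..γ, e₀ ζ) :
    (∀ E : Set ℝ, Bornology.IsBounded E → MeasurableSet E →
      ENNReal.ofReal (a * ∫ α in E, e₀ α) ≤ volume (F '' E) ∧
      volume (F '' E) ≤ ENNReal.ofReal (b * ∫ α in E, e₀ α)) ∧
    volume (F '' {α : ℝ | e₀ α = 0}) = 0 := by
  have hb : 0 < b := ha.trans_le hab
  have hint : ∀ x y, IntervalIntegrable e₀ volume x y := fun x y => he₀c.intervalIntegrable x y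
  have hG : ∀ x, HasDerivAt (fun x => ∫ ζ in (0:ℝ)..x, e₀ ζ) (e₀ x) x := fun x =>
    intervalIntegral.integral_hasDerivAt_right (hint _ _)
      he₀c.aestronglyMeasurable.stronglyMeasurableAtFilter he₀c.continuousAt
  have hsub : ∀ x y, (∫ ζ in (0:ℝ)..y, e₀ ζ) - (∫ ζ in (0:ℝ)..x, e₀ ζ) = ∫ ζ in x..y, e₀ ζ :=
    fun x y => intervalIntegral.integral_interval_sub_left (hint _ _) (hint _ _)
  have hnn : ∀ x y, x ≤ y → 0 ≤ ∫ ζ in x..y, e₀ ζ := fun x y h =>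
    intervalIntegral.integral_nonneg h (fun u _ => he₀ u)
  have hmono : Monotone F := fun x y h => by
    have := (hF x y h).1
    have := mul_nonneg ha.le (hnn x y h)
    linarith
  have hm1 : Monotone (fun x => F x - a * ∫ ζ in (0:ℝ)..x, e₀ ζ) := fun x y h => by
    have := (hF x y h).1
    rw [← hsub] at this
    simp only
    linarith
  have hm2 : Monotone (fun x => b * (∫ ζ in (0:ℝ)..x, e₀ ζ) - F x) := fun x y h => by
    have := (hF x y h).2
    rw [← hsub] at this
    simp only
    linarith
  have hd1 : ∀ x, DifferentiableAt ℝ F x → a * e₀ x ≤ deriv F x := fun x hx => by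
    have h := hx.hasDerivAt.sub ((hG x).const_mul a)
    have h2 := hm1.deriv_nonneg (x := x)
    have h3 := h.deriv
    have : 0 ≤ deriv F x - a * e₀ x := by rw [← h3]; exact h2
    linarith
  have hd2 : ∀ x, DifferentiableAt ℝ F x → deriv F x ≤ b * e₀ x := fun x hx => by
    have h := ((hG x).const_mul b).sub hx.hasDerivAt
    have h2 := hm2.deriv_nonneg (x := x)
    have h3 := h.deriv
    have : 0 ≤ b * e₀ x - deriv F x := by rw [← h3]; exact h2
    linarith
  have main : ∀ E : Set ℝ, Bornology.IsBounded E → MeasurableSet E →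
      ENNReal.ofReal (a * ∫ α in E, e₀ α) ≤ volume (F '' E) ∧
      volume (F '' E) ≤ ENNReal.ofReal (b * ∫ α in E, e₀ α) := by
    intro E hE hEm
    obtain ⟨R, hR⟩ := hE.subset_closedBall 0
    rw [Real.closedBall_eq_Icc] at hR
    have hei : IntegrableOn e₀ E := (he₀c.integrableOn_Icc).mono_set hR
    obtain ⟨K, hK⟩ := (isCompact_Icc (a := 0 - R) (b := 0 + R)).bddAbove_image he₀c.continuousOn
    have hK' : ∀ x ∈ Set.Icc (0 - R) (0 + R), e₀ x ≤ K := fun x hx => hK ⟨x, hx, rfl⟩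
    have hle : ∀ x ∈ E, ∀ y ∈ E, x ≤ y → F y - F x ≤ b * K * (y - x) := by
      intro x hx y hy h
      have h1 : ∫ ζ in x..y, e₀ ζ ≤ ∫ ζ in x..y, K :=
        intervalIntegral.integral_mono_on h (hint _ _) (by simp) (fun u hu =>
          hK' u ⟨(hR hx).1.trans hu.1, hu.2.trans (hR hy).2⟩)
      simp only [intervalIntegral.integral_const, smul_eq_mul] at h1
      have := (hF x y h).2
      nlinarith
    have hlip : LipschitzOnWith (b * K).toNNReal F E := by
      refine LipschitzOnWith.of_dist_le_mul fun x hx y hy => ?_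
      have hc := Real.le_coe_toNNReal (b * K)
      have hc0 := (b * K).toNNReal.2
      rcases le_total x y with h | h
      · rw [dist_comm, dist_comm x, Real.dist_eq, Real.dist_eq, abs_of_nonneg (sub_nonneg.2 (hmono h)),
          abs_of_nonneg (sub_nonneg.2 h)]
        exact (hle x hx y hy h).trans (mul_le_mul_of_nonneg_right hc (sub_nonneg.2 h))
      · rw [Real.dist_eq, Real.dist_eq, abs_of_nonneg (sub_nonneg.2 (hmono h)),
          abs_of_nonneg (sub_nonneg.2 h)]
        exact (hle y hy x hx h).trans (mul_le_mul_of_nonneg_right hc (sub_nonneg.2 h))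
    set D : Set ℝ := {x | DifferentiableAt ℝ F x} with hD
    have hDm : MeasurableSet D := measurableSet_of_differentiableAt ℝ F
    have hD0 : volume Dᶜ = 0 := hmono.ae_differentiableAt
    have hnull : volume (F '' (E \ D)) = 0 := by
      have hED : volume (E \ D) = 0 := measure_mono_null (fun x hx => hx.2) hD0
      have h := (hlip.mono Set.sdiff_subset : LipschitzOnWith _ F (E \ D)).hausdorffMeasure_image_le
        (d := 1) zero_le_one
      rw [hausdorffMeasure_real, hED, mul_zero] at h
      exact le_antisymm h bot_le
    have himg : volume (F '' E) = volume (F '' (E ∩ D)) := by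
      apply le_antisymm
      · rw [← Set.inter_union_sdiff E D, Set.image_union]
        refine (measure_union_le _ _).trans ?_
        rw [Set.inter_union_sdiff, hnull, add_zero]
      · exact measure_mono (Set.image_mono Set.inter_subset_left)
    have hcov : ∫⁻ x in E ∩ D, ENNReal.ofReal (deriv F x) = volume (F '' (E ∩ D)) :=
      lintegral_deriv_eq_volume_image_of_monotoneOn (hEm.inter hDm)
        (fun x hx => (hx.2 : DifferentiableAt ℝ F x).hasDerivAt.hasDerivWithinAt)
        (hmono.monotoneOn _)
    have hconst : ∀ c, 0 ≤ c → ENNReal.ofReal (c * ∫ α in E, e₀ α)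
        = ∫⁻ x in E ∩ D, ENNReal.ofReal (c * e₀ x) := by
      intro c hc
      rw [← integral_const_mul, ofReal_integral_eq_lintegral_ofReal (hei.const_mul c)
        (Filter.Eventually.of_forall fun x => mul_nonneg hc (he₀ x))]
      apply setLIntegral_congr
      have : D =ᵐ[volume] Set.univ := ae_eq_univ.2 hD0
      simpa using (Filter.EventuallyEq.refl _ E |>.inter this).symm
    rw [himg, ← hcov, hconst a ha.le, hconst b hb.le]
    exact ⟨setLIntegral_mono' (hEm.inter hDm) fun x hx => ENNReal.ofReal_le_ofReal (hd1 x hx.2),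
      setLIntegral_mono' (hEm.inter hDm) fun x hx => ENNReal.ofReal_le_ofReal (hd2 x hx.2)⟩
  refine ⟨main, ?_⟩
  have hZ : {α : ℝ | e₀ α = 0} = ⋃ n : ℕ, {α : ℝ | e₀ α = 0} ∩ Metric.closedBall 0 n := by
    rw [← Set.inter_iUnion, Metric.iUnion_closedBall_nat, Set.inter_univ]
  rw [hZ, Set.image_iUnion, measure_iUnion_null_iff]
  intro n
  have hm : MeasurableSet ({α : ℝ | e₀ α = 0} ∩ Metric.closedBall 0 n) :=
    (isClosed_eq he₀c continuous_const).measurableSet.inter Metric.isClosed_closedBall.measurableSet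
  have h := (main _ (Metric.isBounded_closedBall.subset Set.inter_subset_right) hm).2
  rw [setIntegral_congr_fun hm (g := fun _ => (0:ℝ)) (fun x hx => hx.1)] at h
  simpa using h
end

section
/- Let d ≥ 0, let e₀ : ℝ × ℝ^d → ℝ be continuous and nonnegative, with zero set Z := {α : e₀(α) = 0} and positivity set P := {α : e₀(α) > 0}. Suppose X̄ : ℝ × ℝ^d → ℝ × ℝ^d is continuous, has the form X̄(α₁, α₋) = (X̄₁(α₁, α₋), α₋), and satisfies the slice-wise two-sided bound: there are constants 0 < a ≤ b such that for every α₋ ∈ ℝ^d and all reals β ≤ γ, a·∫_β^γ e₀(ζ, α₋) dζ ≤ X̄₁(γ, α₋) − X̄₁(β, α₋) ≤ b·∫_β^γ e₀(ζ, α₋) dζ. Let ρ₀ : ℝ × ℝ^d → [0,∞) be Lebesgue integrable and let ν be a finite Borel measure on ℝ × ℝ^d that is mutually singular with Lebesgue measure λ. Then the pushforward X̄♯(ρ₀·1_P·λ) is absolutely continuous with respect to λ, and the pushforward X̄♯(ρ₀·1_Z·λ + ν) is mutually singular with respect to λ; consequently X̄♯(ρ₀·λ + ν) = X̄♯(ρ₀·1_P·λ)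 + X̄♯(ρ₀·1_Z·λ + ν) is the Lebesgue decomposition of X̄♯(ρ₀·λ + ν) with respect to λ. -/
open MeasureTheory

lemma null_transfer (f F : ℝ → ℝ) (A : Set ℝ) (C : ℝ) (hC : 0 ≤ C)
    (h : ∀ x ∈ A, ∀ y ∈ A, |F x - F y| ≤ C * |f x - f y|)
    (h0 : volume (f '' A) = 0) : volume (F '' A) = 0 := by
  have hch : ∀ z : ℝ, ∃ x, z ∈ f '' A → x ∈ A ∧ f x = z := by
    intro z
    by_cases hz : z ∈ f '' A
    · obtain ⟨x, hx, hxz⟩ := hz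
      exact ⟨x, fun _ => ⟨hx, hxz⟩⟩
    · exact ⟨0, fun h => absurd h hz⟩
  choose k hk using hch
  have hL : LipschitzOnWith C.toNNReal (fun z => F (k z)) (f '' A) := by
    apply LipschitzOnWith.of_dist_le_mul
    intro z hz w hw
    have := h _ (hk z hz).1 _ (hk w hw).1
    rw [(hk z hz).2, (hk w hw).2] at this
    simpa [Real.dist_eq, Real.coe_toNNReal C hC] using this
  have hsub : F '' A ⊆ (fun z => F (k z)) '' (f '' A) := by
    rintro _ ⟨x, hx, rfl⟩
    have hm : f x ∈ f '' A := ⟨x, hx, rfl⟩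
    refine ⟨f x, hm, ?_⟩
    have := h _ (hk _ hm).1 x hx
    rw [(hk _ hm).2] at this
    simp only [sub_self, abs_zero, mul_zero] at this
    have := abs_nonpos_iff.mp this
    simp only
    linarith
  have hle := hL.hausdorffMeasure_image_le (d := 1) zero_le_one
  rw [hausdorffMeasure_real, h0, mul_zero] at hle
  exact measure_mono_null hsub (le_antisymm hle (zero_le))

section slice
lemma prim_deriv (g : ℝ → ℝ) (hg : Continuous g) (x : ℝ) :
    HasDerivAt (fun u => ∫ t in (0:ℝ)..u, g t) (g x) x :=
  intervalIntegral.integral_hasDerivAt_right (hg.intervalIntegrable _ _)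
    (hg.stronglyMeasurableAtFilter _ _) hg.continuousAt

lemma prim_sub (g : ℝ → ℝ) (hg : Continuous g) (x y : ℝ) :
    (∫ t in (0:ℝ)..y, g t) - (∫ t in (0:ℝ)..x, g t) = ∫ t in x..y, g t :=
  intervalIntegral.integral_interval_sub_left (hg.intervalIntegrable _ _)
    (hg.intervalIntegrable _ _)

lemma prim_mono (g : ℝ → ℝ) (hg : Continuous g) (hg0 : ∀ x, 0 ≤ g x) :
    Monotone (fun u => ∫ t in (0:ℝ)..u, g t) := by
  intro x y hxy
  have := prim_sub g hg x y
  have h2 : 0 ≤ ∫ t in x..y, g t := intervalIntegral.integral_nonneg hxy (fun t _ => hg0 t)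
  simp only
  linarith

lemma slice_bounds (g f : ℝ → ℝ) (hg : Continuous g) (hg0 : ∀ x, 0 ≤ g x) (a b : ℝ)
    (ha : 0 < a)
    (hX : ∀ β γ : ℝ, β ≤ γ → a * ∫ ζ in β..γ, g ζ ≤ f γ - f β ∧
      f γ - f β ≤ b * ∫ ζ in β..γ, g ζ) (x y : ℝ) :
    a * |(∫ t in (0:ℝ)..x, g t) - (∫ t in (0:ℝ)..y, g t)| ≤ |f x - f y| ∧
    |f x - f y| ≤ b * |(∫ t in (0:ℝ)..x, g t) - (∫ t in (0:ℝ)..y, g t)| := by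
  wlog hxy : y ≤ x generalizing x y
  · have := this y x (le_of_not_ge hxy)
    rwa [abs_sub_comm (f x), abs_sub_comm (∫ t in (0:ℝ)..x, g t)]
  · rw [prim_sub g hg]
    have h2 : 0 ≤ ∫ t in y..x, g t := intervalIntegral.integral_nonneg hxy (fun t _ => hg0 t)
    obtain ⟨h3, h4⟩ := hX y x hxy
    have h5 : 0 ≤ f x - f y := le_trans (by positivity) h3
    rw [abs_of_nonneg h2, abs_of_nonneg h5]
    exact ⟨h3, h4⟩

lemma slice_ac (g f : ℝ → ℝ) (hg : Continuous g) (hg0 : ∀ x, 0 ≤ g x) (a b : ℝ)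
    (ha : 0 < a) (hf : Measurable f)
    (hX : ∀ β γ : ℝ, β ≤ γ → a * ∫ ζ in β..γ, g ζ ≤ f γ - f β ∧
      f γ - f β ≤ b * ∫ ζ in β..γ, g ζ) (N : Set ℝ) (hN : MeasurableSet N)
    (hN0 : volume N = 0) : volume ({x | 0 < g x} ∩ f ⁻¹' N) = 0 := by
  set A := {x | 0 < g x} ∩ f ⁻¹' N with hA
  have hAm : MeasurableSet A := (measurableSet_lt measurable_const hg.measurable).inter (hf hN)
  have h1 : volume (f '' A) = 0 :=
    measure_mono_null (by rintro _ ⟨x, hx, rfl⟩; exact hx.2) hN0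
  have h2 := null_transfer f (fun u => ∫ t in (0:ℝ)..u, g t) A a⁻¹ (by positivity)
    (fun x _ y _ => by
      have := (slice_bounds g f hg hg0 a b ha hX x y).1
      rw [inv_mul_eq_div, le_div_iff₀ ha, mul_comm]
      exact this) h1
  rw [← lintegral_deriv_eq_volume_image_of_monotoneOn hAm
    (fun x _ => (prim_deriv g hg x).hasDerivWithinAt) ((prim_mono g hg hg0).monotoneOn _),
    setLIntegral_eq_zero_iff hAm (by fun_prop)] at h2
  rw [measure_eq_zero_iff_ae_notMem]
  filter_upwards [h2] with x hx hxA
  have := hx hxA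
  rw [ENNReal.ofReal_eq_zero] at this
  exact absurd hxA.1 (not_lt.mpr this)

lemma slice_sing (g f : ℝ → ℝ) (hg : Continuous g) (hg0 : ∀ x, 0 ≤ g x) (a b : ℝ)
    (ha : 0 < a) (hab : a ≤ b)
    (hX : ∀ β γ : ℝ, β ≤ γ → a * ∫ ζ in β..γ, g ζ ≤ f γ - f β ∧
      f γ - f β ≤ b * ∫ ζ in β..γ, g ζ) (N : Set ℝ)
    (hN0 : volume N = 0) : volume (f '' ({x | g x = 0} ∪ N)) = 0 := by
  refine null_transfer (fun u => ∫ t in (0:ℝ)..u, g t) f _ b (ha.le.trans hab)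
    (fun x _ y _ => (slice_bounds g f hg hg0 a b ha hX x y).2) ?_
  rw [Set.image_union, measure_union_null_iff]
  have hZ : MeasurableSet {x | g x = 0} := measurableSet_eq_fun hg.measurable measurable_const
  constructor
  · rw [← lintegral_deriv_eq_volume_image_of_monotoneOn hZ
      (fun x _ => (prim_deriv g hg x).hasDerivWithinAt) ((prim_mono g hg hg0).monotoneOn _),
      setLIntegral_eq_zero_iff hZ (by fun_prop)]
    filter_upwards with x hx
    simp [show g x = 0 from hx]
  · exact addHaar_image_eq_zero_of_differentiableOn_of_addHaar_eq_zero _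
      (fun x _ => (prim_deriv g hg x).differentiableAt.differentiableWithinAt) hN0
end slice

lemma null_iff_slices {d : ℕ} {s : Set (ℝ × (Fin d → ℝ))} (hs : MeasurableSet s) :
    volume s = 0 ↔ ∀ᵐ y : Fin d → ℝ, volume ((fun x : ℝ => (x, y)) ⁻¹' s) = 0 := by
  rw [Measure.volume_eq_prod, Measure.prod_apply_symm hs,
    lintegral_eq_zero_iff (measurable_measure_prodMk_right hs)]
  rfl

lemma exists_sigmaCompact {X : Type*} [TopologicalSpace X] [MeasurableSpace X] [T2Space X]
    [BorelSpace X]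
    (ν : Measure X) [IsFiniteMeasure ν] [ν.InnerRegularCompactLTTop] (S : Set X)
    (hS : MeasurableSet S) :
    ∃ K ⊆ S, IsSigmaCompact K ∧ ν (S \ K) = 0 := by
  have : ∀ n : ℕ, ∃ K ⊆ S, IsCompact K ∧ ν (S \ K) < ((n : ENNReal) + 1)⁻¹ := fun n =>
    hS.exists_isCompact_sdiff_lt (measure_ne_top _ _) (by simp)
  choose K hKS hK hlt using this
  refine ⟨⋃ n, K n, Set.iUnion_subset hKS, isSigmaCompact_iUnion_of_isCompact _ hK, ?_⟩
  refine le_antisymm ?_ zero_le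
  have ht : Filter.Tendsto (fun n : ℕ => ((n : ENNReal) + 1)⁻¹) Filter.atTop (nhds 0) := by
    have := (Filter.tendsto_add_atTop_iff_nat 1).mpr ENNReal.tendsto_inv_nat_nhds_zero
    simpa using this
  refine ge_of_tendsto' ht (fun n => le_trans (measure_mono ?_) (hlt n).le)
  exact Set.diff_subset_diff_right (Set.subset_iUnion K n)

lemma IsSigmaCompact.measurableSet' {X : Type*} [TopologicalSpace X] [MeasurableSpace X]
    [T2Space X] [BorelSpace X] {s : Set X} (hs : IsSigmaCompact s) : MeasurableSet s := by
  obtain ⟨K, hK, rfl⟩ := hs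
  exact MeasurableSet.iUnion fun n => (hK n).measurableSet

/-- Theorem 1.2 (t:main), structural part: the pushforward of the absolutely continuous part of
the initial mass restricted to the positivity set `P` of the entropy is absolutely continuous,
the pushforward of the part carried by the zero set `Z` together with the singular part `ν` is
singular, and these two pieces form the Lebesgue decomposition of the limiting mass measure
`X̄♯(ρ₀·λ + ν)`. -/
theorem stmt_6 (d : ℕ) (e₀ : ℝ × (Fin d → ℝ) → ℝ) (he₀c : Continuous e₀)
    (he₀ : ∀ α, 0 ≤ e₀ α)
    (Xbar₁ : ℝ × (Fin d → ℝ) → ℝ)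
    (Xbar : ℝ × (Fin d → ℝ) → ℝ × (Fin d → ℝ))
    (hXform : ∀ α, Xbar α = (Xbar₁ α, α.2))
    (hXc : Continuous Xbar)
    (a b : ℝ) (ha : 0 < a) (hab : a ≤ b)
    (hX : ∀ (αm : Fin d → ℝ) (β γ : ℝ), β ≤ γ →
      a * ∫ ζ in β..γ, e₀ (ζ, αm) ≤ Xbar₁ (γ, αm) - Xbar₁ (β, αm) ∧
      Xbar₁ (γ, αm) - Xbar₁ (β, αm) ≤ b * ∫ ζ in β..γ, e₀ (ζ, αm))
    (ρ₀ : ℝ × (Fin d → ℝ) → ℝ) (hρ₀ : ∀ α, 0 ≤ ρ₀ α) (hρint : Integrable ρ₀)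
    (ν : Measure (ℝ × (Fin d → ℝ))) [IsFiniteMeasure ν] (hν : ν ⟂ₘ volume) :
    Measure.map Xbar ((volume.restrict {α | 0 < e₀ α}).withDensity
        (fun α => ENNReal.ofReal (ρ₀ α))) ≪ volume ∧
    Measure.map Xbar ((volume.restrict {α | e₀ α = 0}).withDensity
        (fun α => ENNReal.ofReal (ρ₀ α)) + ν) ⟂ₘ volume ∧
    Measure.map Xbar (volume.withDensity (fun α => ENNReal.ofReal (ρ₀ α)) + ν) =
      Measure.map Xbar ((volume.restrict {α | 0 < e₀ α}).withDensity
        (fun α => ENNReal.ofReal (ρ₀ α))) +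
      Measure.map Xbar ((volume.restrict {α | e₀ α = 0}).withDensity
        (fun α => ENNReal.ofReal (ρ₀ α)) + ν) := by
  classical
  have hXm : Measurable Xbar := hXc.measurable
  have hf : ∀ y : Fin d → ℝ, Continuous (fun x : ℝ => Xbar₁ (x, y)) := by
    intro y
    have : (fun x : ℝ => Xbar₁ (x, y)) = fun x : ℝ => (Xbar (x, y)).1 := by
      funext x; rw [hXform]
    rw [this]; fun_prop
  have hg : ∀ y : Fin d → ℝ, Continuous (fun x : ℝ => e₀ (x, y)) := fun y => by fun_prop
  have hP : MeasurableSet {α | 0 < e₀ α} := measurableSet_lt measurable_const he₀c.measurable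
  have hZc : IsClosed {α | e₀ α = 0} := isClosed_eq he₀c continuous_const
  have hZ : MeasurableSet {α | e₀ α = 0} := hZc.measurableSet
  have hPZ : {α | 0 < e₀ α}ᶜ = {α | e₀ α = 0} := by
    ext α
    simp only [Set.mem_compl_iff, Set.mem_setOf_eq, not_lt]
    exact ⟨fun h => le_antisymm h (he₀ α), fun h => h.le⟩
  refine ⟨?_, ?_, ?_⟩
  · refine Measure.AbsolutelyContinuous.mk fun N hN hN0 => ?_
    rw [Measure.map_apply hXm hN]
    apply withDensity_absolutelyContinuous
    rw [Measure.restrict_apply (hXm hN), null_iff_slices ((hXm hN).inter hP)]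
    rw [null_iff_slices hN] at hN0
    filter_upwards [hN0] with y hy
    have := slice_ac _ _ (hg y) (fun x => he₀ _) a b ha (hf y).measurable (hX y) _
      (measurable_prodMk_right hN) hy
    refine measure_mono_null ?_ this
    rintro x ⟨hx1, hx2⟩
    refine ⟨hx2, ?_⟩
    have h3 : Xbar (x, y) ∈ N := hx1
    rw [hXform] at h3
    exact h3
  · obtain ⟨S, hS, hνS, hSv⟩ := hν
    obtain ⟨K, hKS, hK, hK0⟩ := exists_sigmaCompact ν Sᶜ hS.compl
    have hKv : volume K = 0 := measure_mono_null hKS hSv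
    have hTc : IsSigmaCompact ({α | e₀ α = 0} ∪ K) := by
      have h1 := isSigmaCompact_univ.of_isClosed_subset hZc (Set.subset_univ _)
      rw [Set.union_eq_iUnion]
      exact isSigmaCompact_iUnion _ (fun b => by cases b <;> assumption)
    have hIm : MeasurableSet (Xbar '' ({α | e₀ α = 0} ∪ K)) :=
      (hTc.image hXc).measurableSet'
    refine ⟨(Xbar '' ({α | e₀ α = 0} ∪ K))ᶜ, hIm.compl, ?_, ?_⟩
    · rw [Measure.map_apply hXm hIm.compl]
      have hsub : Xbar ⁻¹' (Xbar '' ({α | e₀ α = 0} ∪ K))ᶜ ⊆ ({α | e₀ α = 0} ∪ K)ᶜ :=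
        fun x hx hxT => hx ⟨x, hxT, rfl⟩
      refine measure_mono_null hsub ?_
      rw [Measure.add_apply, add_eq_zero]
      constructor
      · apply withDensity_absolutelyContinuous
        rw [Measure.restrict_apply hTc.measurableSet'.compl]
        refine measure_mono_null (t := ∅) ?_ measure_empty
        rintro x ⟨h1, h2⟩
        exact h1 (Or.inl h2)
      · refine measure_mono_null (t := S ∪ (Sᶜ \ K)) ?_ (measure_union_null hνS hK0)
        intro x hx
        by_cases hxS : x ∈ S
        · exact Or.inl hxS
        · exact Or.inr ⟨hxS, fun h => hx (Or.inr h)⟩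
    · rw [compl_compl, null_iff_slices hIm]
      rw [null_iff_slices hK.measurableSet'] at hKv
      filter_upwards [hKv] with y hy
      have := slice_sing _ _ (hg y) (fun x => he₀ _) a b ha hab (hX y) _ hy
      refine measure_mono_null ?_ this
      rintro x ⟨⟨t, y'⟩, ht, hxt⟩
      rw [hXform] at hxt
      obtain ⟨h1, h2⟩ := Prod.mk.inj hxt
      simp only at h2
      subst h2
      exact ⟨t, ht, h1⟩
  · rw [← Measure.map_add _ _ hXm, ← add_assoc,
      ← withDensity_add_measure, ← hPZ, Measure.restrict_add_restrict_compl hP]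
end

section
/- Let d ≥ 0, let e₀ : ℝ × ℝ^d → ℝ be continuous and nonnegative, with zero set Z := {α : e₀(α) = 0}. Suppose X̄ : ℝ × ℝ^d → ℝ × ℝ^d is continuous, has the form X̄(α₁, α₋) = (X̄₁(α₁, α₋), α₋), and satisfies the slice-wise two-sided bound: there are constants 0 < a ≤ b such that for every α₋ ∈ ℝ^d and all reals β ≤ γ, a·∫_β^γ e₀(ζ, α₋) dζ ≤ X̄₁(γ, α₋) − X̄₁(β, α₋) ≤ b·∫_β^γ e₀(ζ, α₋) dζ. Let ρ₀ : ℝ × ℝ^d → [0,∞) be Lebesgue integrable, let ν be a finite Borel measure mutually singular with Lebesgue measure λ, and set m₀ := ρ₀·λ + ν. Then the pushforward X̄♯m₀ is absolutely continuous with respect to λ if and only if ∫_Z ρ₀ dλ = 0 and ν = 0. -/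
open MeasureTheory

lemma aux_slice {d : ℕ} {S : Set (ℝ × (Fin d → ℝ))} (hS : MeasurableSet S) :
    volume S = 0 ↔ ∀ᵐ y : Fin d → ℝ, volume ((fun x : ℝ => (x, y)) ⁻¹' S) = 0 := by
  rw [Measure.volume_eq_prod, Measure.prod_apply_symm hS,
    lintegral_eq_zero_iff (measurable_measure_prodMk_right hS)]
  rfl

lemma aux_lip {f : ℝ → ℝ} {K : NNReal} {s : Set ℝ} (hf : LipschitzOnWith K f s)
    (hs : volume s = 0) : volume (f '' s) = 0 := by
  have h := hf.hausdorffMeasure_image_le (d := 1) zero_le_one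
  rw [hausdorffMeasure_real, hs] at h
  simpa using h

lemma aux_null {f e : ℝ → ℝ} (he : Continuous e) (he0 : ∀ x, 0 ≤ e x) {a b : ℝ} (ha : 0 < a)
    (hab : a ≤ b)
    (h : ∀ β γ : ℝ, β ≤ γ → a * ∫ ζ in β..γ, e ζ ≤ f γ - f β ∧ f γ - f β ≤ b * ∫ ζ in β..γ, e ζ)
    {S : Set ℝ} (hS : volume S = 0) : volume (f '' S) = 0 := by
  have hU : S = ⋃ n : ℕ, S ∩ Set.Icc (-(n:ℝ)) n := by
    rw [← Set.inter_iUnion]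
    refine (Set.inter_eq_left.2 fun x _ => ?_).symm
    obtain ⟨n, hn⟩ := exists_nat_ge |x|
    exact Set.mem_iUnion.2 ⟨n, abs_le.1 hn⟩
  rw [hU, Set.image_iUnion]
  refine measure_iUnion_null fun n => ?_
  obtain ⟨M, hM⟩ := (isCompact_Icc (a := -(n:ℝ)) (b := n)).bddAbove_image he.continuousOn
  have hM' : ∀ x ∈ Set.Icc (-(n:ℝ)) n, e x ≤ M := fun x hx => hM ⟨x, hx, rfl⟩
  have hb : 0 < b := ha.trans_le hab
  have key : ∀ x ∈ Set.Icc (-(n:ℝ)) n, ∀ y ∈ Set.Icc (-(n:ℝ)) n, x ≤ y →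
      |f y - f x| ≤ b * M * (y - x) := by
    intro x hx y hy hxy
    have h1 := h x y hxy
    have h2 : 0 ≤ ∫ ζ in x..y, e ζ := intervalIntegral.integral_nonneg hxy fun u _ => he0 u
    have h3 : ∫ ζ in x..y, e ζ ≤ ∫ ζ in x..y, M :=
      intervalIntegral.integral_mono_on hxy (he.intervalIntegrable _ _) (by simp)
        fun u hu => hM' u ⟨hx.1.trans hu.1, hu.2.trans hy.2⟩
    simp only [intervalIntegral.integral_const, smul_eq_mul] at h3
    rw [abs_of_nonneg (le_trans (by positivity) h1.1)]
    nlinarith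
  have hL : LipschitzOnWith (b * M).toNNReal f (S ∩ Set.Icc (-(n:ℝ)) n) := by
    refine LipschitzOnWith.of_dist_le_mul fun x hx y hy => ?_
    have : b * M ≤ ((b * M).toNNReal : ℝ) := Real.le_coe_toNNReal _
    rcases le_total x y with hxy | hxy
    · rw [dist_comm, dist_comm x y, Real.dist_eq, Real.dist_eq, abs_of_nonneg (sub_nonneg.2 hxy)]
      exact (key x hx.2 y hy.2 hxy).trans (by gcongr)
    · rw [Real.dist_eq, Real.dist_eq, abs_of_nonneg (sub_nonneg.2 hxy)]
      exact (key y hy.2 x hx.2 hxy).trans (by gcongr)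
  exact aux_lip hL (measure_mono_null Set.inter_subset_left hS)

lemma aux_sard {f e : ℝ → ℝ} (he : Continuous e) (he0 : ∀ x, 0 ≤ e x) {a b : ℝ} (ha : 0 < a)
    (hab : a ≤ b)
    (h : ∀ β γ : ℝ, β ≤ γ → a * ∫ ζ in β..γ, e ζ ≤ f γ - f β ∧ f γ - f β ≤ b * ∫ ζ in β..γ, e ζ)
    {S : Set ℝ} (hS : ∀ x ∈ S, e x = 0) : volume (f '' S) = 0 := by
  have hb : 0 < b := ha.trans_le hab
  have hd : ∀ x ∈ S, HasDerivAt f 0 x := by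
    intro x hx
    have h1 : HasDerivAt (fun u => ∫ ζ in x..u, e ζ) (e x) x :=
      intervalIntegral.integral_hasDerivAt_right (he.intervalIntegrable _ _)
        (he.stronglyMeasurableAtFilter _ _) he.continuousAt
    rw [hS x hx, hasDerivAt_iff_isLittleO] at h1
    rw [hasDerivAt_iff_isLittleO]
    refine Asymptotics.IsBigO.trans_isLittleO ?_ h1
    refine Asymptotics.IsBigO.of_bound b (Filter.Eventually.of_forall fun y => ?_)
    simp only [smul_zero, sub_zero, intervalIntegral.integral_same, Real.norm_eq_abs]
    rcases le_total x y with hxy | hxy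
    · have h2 : 0 ≤ ∫ ζ in x..y, e ζ := intervalIntegral.integral_nonneg hxy fun u _ => he0 u
      have h3 := h x y hxy
      rw [abs_of_nonneg h2, abs_of_nonneg (le_trans (by positivity) h3.1)]
      exact h3.2
    · have h2 : 0 ≤ ∫ ζ in y..x, e ζ := intervalIntegral.integral_nonneg hxy fun u _ => he0 u
      have h3 := h y x hxy
      rw [intervalIntegral.integral_symm, abs_neg, abs_sub_comm, abs_of_nonneg h2,
        abs_of_nonneg (le_trans (by positivity) h3.1)]
      exact h3.2
  refine addHaar_image_eq_zero_of_det_fderivWithin_eq_zero volume (f' := fun _ => 0)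
    (fun x hx => ?_) (fun x _ => by simp)
  have := (hd x hx).hasFDerivAt.hasFDerivWithinAt (s := S)
  simpa using this

lemma aux_pre {f e : ℝ → ℝ} (he : Continuous e) {a : ℝ} (ha : 0 < a)
    (h : ∀ β γ : ℝ, β ≤ γ → a * ∫ ζ in β..γ, e ζ ≤ f γ - f β)
    {B : Set ℝ} (hB : volume B = 0) : volume (f ⁻¹' B ∩ {x | 0 < e x}) = 0 := by
  refine measure_null_of_locally_null _ fun x hx => ?_
  have hx0 : 0 < e x := hx.2
  obtain ⟨r, hr, hr'⟩ := Metric.eventually_nhds_iff_ball.1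
    (he.continuousAt.eventually (lt_mem_nhds (half_lt_self hx0)))
  refine ⟨Metric.ball x r ∩ (f ⁻¹' B ∩ {x | 0 < e x}), Filter.inter_mem
    (mem_nhdsWithin_of_mem_nhds (Metric.ball_mem_nhds x hr)) self_mem_nhdsWithin, ?_⟩
  set c := a * (e x / 2) with hc
  have hc0 : 0 < c := by positivity
  set T := Metric.ball x r ∩ (f ⁻¹' B ∩ {x | 0 < e x}) with hT
  have key : ∀ y ∈ Metric.ball x r, ∀ z ∈ Metric.ball x r, y ≤ z → c * (z - y) ≤ f z - f y := by
    intro y hy z hz hyz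
    refine le_trans ?_ (h y z hyz)
    have h3 : ∫ ζ in y..z, (e x / 2) ≤ ∫ ζ in y..z, e ζ := by
      refine intervalIntegral.integral_mono_on hyz (by simp) (he.intervalIntegrable _ _)
        fun u hu => (hr' u ?_).le
      rw [Real.ball_eq_Ioo] at *
      exact ⟨hy.1.trans_le hu.1, hu.2.trans_lt hz.2⟩
    simp only [intervalIntegral.integral_const, smul_eq_mul] at h3
    nlinarith
  have key2 : ∀ y ∈ T, ∀ z ∈ T, dist y z ≤ c⁻¹ * dist (f y) (f z) := by
    intro y hy z hz
    rw [inv_mul_eq_div, le_div_iff₀ hc0, mul_comm]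
    rcases le_total y z with hyz | hyz
    · rw [dist_comm, dist_comm (f y), Real.dist_eq, Real.dist_eq,
        abs_of_nonneg (sub_nonneg.2 hyz)]
      exact (key y hy.1 z hz.1 hyz).trans (le_abs_self _)
    · rw [Real.dist_eq, Real.dist_eq, abs_of_nonneg (sub_nonneg.2 hyz)]
      exact (key z hz.1 y hy.1 hyz).trans (le_abs_self _)
  have hinj : Set.InjOn f T := fun y hy z hz hyz => by
    have := key2 y hy z hz
    rw [hyz, dist_self, mul_zero] at this
    exact dist_le_zero.1 this
  have hg : LipschitzOnWith (c⁻¹).toNNReal (Function.invFunOn f T) (f '' T) := by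
    refine LipschitzOnWith.of_dist_le_mul ?_
    rintro _ ⟨y, hy, rfl⟩ _ ⟨z, hz, rfl⟩
    rw [hinj.leftInvOn_invFunOn hy, hinj.leftInvOn_invFunOn hz,
      Real.coe_toNNReal _ (by positivity)]
    exact key2 y hy z hz
  have hfT : volume (f '' T) = 0 := measure_mono_null (by
    rintro _ ⟨y, hy, rfl⟩
    exact hy.2.1) hB
  have := aux_lip hg hfT
  rwa [hinj.leftInvOn_invFunOn.image_image] at this

/-- Theorem 1.2 (t:main), absolute-continuity criterion: the limiting mass measure
`X̄♯(ρ₀·λ + ν)` is absolutely continuous with respect to Lebesgue measure if and only if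
`∫_Z ρ₀ dλ = 0` and `ν = 0`, where `Z` is the zero set of the entropy `e₀`. -/
theorem stmt_7 (d : ℕ) (e₀ : ℝ × (Fin d → ℝ) → ℝ) (he₀c : Continuous e₀)
    (he₀ : ∀ α, 0 ≤ e₀ α)
    (Xbar₁ : ℝ × (Fin d → ℝ) → ℝ)
    (Xbar : ℝ × (Fin d → ℝ) → ℝ × (Fin d → ℝ))
    (hXform : ∀ α, Xbar α = (Xbar₁ α, α.2))
    (hXc : Continuous Xbar)
    (a b : ℝ) (ha : 0 < a) (hab : a ≤ b)
    (hX : ∀ (αm : Fin d → ℝ) (β γ : ℝ), β ≤ γ →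
      a * ∫ ζ in β..γ, e₀ (ζ, αm) ≤ Xbar₁ (γ, αm) - Xbar₁ (β, αm) ∧
      Xbar₁ (γ, αm) - Xbar₁ (β, αm) ≤ b * ∫ ζ in β..γ, e₀ (ζ, αm))
    (ρ₀ : ℝ × (Fin d → ℝ) → ℝ) (hρ₀ : ∀ α, 0 ≤ ρ₀ α) (hρint : Integrable ρ₀)
    (ν : Measure (ℝ × (Fin d → ℝ))) [IsFiniteMeasure ν] (hν : ν ⟂ₘ volume) :
    Measure.map Xbar (volume.withDensity (fun α => ENNReal.ofReal (ρ₀ α)) + ν) ≪ volume ↔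
      ((∫ α in {α | e₀ α = 0}, ρ₀ α) = 0 ∧ ν = 0) := by
  have hec : ∀ y : Fin d → ℝ, Continuous fun x : ℝ => e₀ (x, y) := fun y => by fun_prop
  have hZc : IsClosed {α | e₀ α = 0} := isClosed_eq he₀c continuous_const
  have hslice : ∀ (K : Set (ℝ × (Fin d → ℝ))) (y : Fin d → ℝ),
      (fun x : ℝ => (x, y)) ⁻¹' (Xbar '' K) =
        (fun x => Xbar₁ (x, y)) '' ((fun x : ℝ => (x, y)) ⁻¹' K) := by
    intro K y
    ext x
    simp only [Set.mem_preimage, Set.mem_image, hXform, Prod.ext_iff]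
    constructor
    · rintro ⟨⟨u, v⟩, hu, h1, h2⟩
      simp only at h1 h2
      subst h2
      exact ⟨u, hu, h1⟩
    · rintro ⟨u, hu, h1⟩
      exact ⟨(u, y), hu, h1, rfl⟩
  have hint : (∫ α in {α | e₀ α = 0}, ρ₀ α) = 0 ↔
      volume.withDensity (fun α => ENNReal.ofReal (ρ₀ α)) {α | e₀ α = 0} = 0 := by
    rw [withDensity_apply _ hZc.measurableSet,
      ← ofReal_integral_eq_lintegral_ofReal hρint.integrableOn
        (Filter.Eventually.of_forall hρ₀), ENNReal.ofReal_eq_zero]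
    exact ⟨fun h => h.le, fun h => le_antisymm h (integral_nonneg hρ₀)⟩
  constructor
  · intro hac
    have hK : ∀ K : Set (ℝ × (Fin d → ℝ)), IsCompact K → volume (Xbar '' K) = 0 →
        volume.withDensity (fun α => ENNReal.ofReal (ρ₀ α)) K = 0 ∧ ν K = 0 := by
      intro K hK h0
      have h1 := hac h0
      rw [Measure.map_apply hXc.measurable (hK.image hXc).measurableSet] at h1
      have h2 := measure_mono_null (Set.subset_preimage_image Xbar K) h1
      simpa using h2
    constructor
    · rw [hint]
      have hU : {α | e₀ α = 0} =
          ⋃ n, compactCovering (ℝ × (Fin d → ℝ)) n ∩ {α | e₀ α = 0} := by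
        rw [← Set.iUnion_inter, iUnion_compactCovering, Set.univ_inter]
      rw [hU]
      refine measure_iUnion_null fun n => ?_
      have hc := (isCompact_compactCovering (ℝ × (Fin d → ℝ)) n).inter_right hZc
      refine (hK _ hc ?_).1
      rw [aux_slice (hc.image hXc).measurableSet]
      refine Filter.Eventually.of_forall fun y => ?_
      rw [hslice]
      exact aux_sard (hec y) (fun x => he₀ _) ha hab (hX y) fun x hx => hx.2
    · by_contra hne
      obtain ⟨N, hN, h1, h2⟩ := hν
      have hpos : 0 < ν Nᶜ := by
        rw [pos_iff_ne_zero]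
        intro h3
        apply hne
        rw [← Measure.measure_univ_eq_zero, ← Set.union_compl_self N]
        exact measure_union_null h1 h3
      obtain ⟨K, hKN, hKc, hKpos⟩ := hN.compl.exists_lt_isCompact hpos
      refine hKpos.ne' (hK K hKc ?_).2
      have h3 := (aux_slice hKc.measurableSet).1 (measure_mono_null hKN h2)
      rw [aux_slice (hKc.image hXc).measurableSet]
      filter_upwards [h3] with y hy
      rw [hslice]
      exact aux_null (hec y) (fun x => he₀ _) ha hab (hX y) hy
  · rintro ⟨h0, rfl⟩
    rw [hint] at h0
    rw [add_zero]
    refine Measure.AbsolutelyContinuous.mk fun A hA hA0 => ?_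
    rw [Measure.map_apply hXc.measurable hA]
    have hm : MeasurableSet (Xbar ⁻¹' A ∩ {α | 0 < e₀ α}) :=
      (hXc.measurable hA).inter (isOpen_lt continuous_const he₀c).measurableSet
    have h1 : volume (Xbar ⁻¹' A ∩ {α | 0 < e₀ α}) = 0 := by
      rw [aux_slice hm]
      filter_upwards [(aux_slice hA).1 hA0] with y hy
      have := aux_pre (hec y) ha (fun β γ hh => (hX y β γ hh).1) hy
      refine measure_mono_null ?_ this
      intro x hx
      refine ⟨?_, hx.2⟩
      have h2 : Xbar (x, y) ∈ A := hx.1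
      rw [hXform] at h2
      exact h2
    refine measure_mono_null ?_
      (measure_union_null (withDensity_absolutelyContinuous _ _ h1) h0)
    intro x hx
    rcases (he₀ x).lt_or_eq with h | h
    · exact Or.inl ⟨hx, h⟩
    · exact Or.inr h.symm
end

section
/- Let d ≥ 1, let e₀ : ℝ × ℝ^d → ℝ be continuous and nonnegative with zero set Z := {α : e₀(α) = 0}, and suppose X̄ : ℝ × ℝ^d → ℝ × ℝ^d has the form X̄(α₁, α₋) = (X̄₁(α₁, α₋), α₋) and satisfies the slice-wise two-sided bound: there are constants 0 < a ≤ b such that for every α₋ ∈ ℝ^d and all reals β ≤ γ, a·∫_β^γ e₀(ζ, α₋) dζ ≤ X̄₁(γ, α₋) − X̄₁(β, α₋) ≤ b·∫_β^γ e₀(ζ, α₋) dζ. Let U ⊆ Z be an open set that is x₁-convex (if (β, α₋) ∈ U and (γ, α₋) ∈ U then ((1−λ)β + λγ, α₋) ∈ U for all λ ∈ [0,1]), let U₋ ⊆ ℝ^d be the projection of U onto the lateral variables, and let f : U₋ → ℝ be a C¹ function whose graph {(f(α₋), α₋) : α₋ ∈ U₋} is contained in U. Assume X̄₁ is continuously differentiable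 on U. Then the function g : U₋ → ℝ defined by g(α₋) := X̄₁(f(α₋), α₋) is C¹, and the image X̄(U) equals the graph {(g(α₋), α₋) : α₋ ∈ U₋}. -/
open MeasureTheory

/-- Theorem 1.4 (t:Xreg), first part: the limiting flow map `X̄` collapses an `x₁`-convex open
subset `U` of the zero set `Z` of the entropy, containing the graph of a `C¹` function `f`,
onto the graph of the `C¹` function `αm ↦ X̄₁(f(αm), αm)`. -/
theorem stmt_8 (d : ℕ) (hd : 1 ≤ d)
    (e₀ : ℝ × (Fin d → ℝ) → ℝ) (he₀c : Continuous e₀) (he₀ : ∀ α, 0 ≤ e₀ α)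
    (Xbar₁ : ℝ × (Fin d → ℝ) → ℝ)
    (Xbar : ℝ × (Fin d → ℝ) → ℝ × (Fin d → ℝ))
    (hXform : ∀ α, Xbar α = (Xbar₁ α, α.2))
    (a b : ℝ) (ha : 0 < a) (hab : a ≤ b)
    (hX : ∀ (αm : Fin d → ℝ) (β γ : ℝ), β ≤ γ →
      a * ∫ ζ in β..γ, e₀ (ζ, αm) ≤ Xbar₁ (γ, αm) - Xbar₁ (β, αm) ∧
      Xbar₁ (γ, αm) - Xbar₁ (β, αm) ≤ b * ∫ ζ in β..γ, e₀ (ζ, αm))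
    (U : Set (ℝ × (Fin d → ℝ))) (hUopen : IsOpen U) (hUZ : U ⊆ {α | e₀ α = 0})
    (hUconv : ∀ (β γ : ℝ) (αm : Fin d → ℝ), (β, αm) ∈ U → (γ, αm) ∈ U →
      ∀ lam ∈ Set.Icc (0:ℝ) 1, ((1 - lam) * β + lam * γ, αm) ∈ U)
    (Um : Set (Fin d → ℝ)) (hUm : Um = {αm | ∃ α₁ : ℝ, (α₁, αm) ∈ U})
    (f : (Fin d → ℝ) → ℝ) (hf : ContDiffOn ℝ 1 f Um)
    (hgraph : ∀ αm ∈ Um, (f αm, αm) ∈ U)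
    (hXreg : ContDiffOn ℝ 1 Xbar₁ U) :
    ContDiffOn ℝ 1 (fun αm => Xbar₁ (f αm, αm)) Um ∧
    Xbar '' U = (fun αm => (Xbar₁ (f αm, αm), αm)) '' Um := by
  refine ⟨hXreg.comp (hf.prodMk contDiffOn_id) hgraph, ?_⟩
  have key : ∀ (αm : Fin d → ℝ) (β γ : ℝ), β ≤ γ → (β, αm) ∈ U → (γ, αm) ∈ U →
      Xbar₁ (γ, αm) = Xbar₁ (β, αm) := by
    intro αm β γ h hβ hγ
    have h0 : ∫ ζ in β..γ, e₀ (ζ, αm) = 0 := by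
      apply intervalIntegral.integral_zero_ae
      refine Filter.Eventually.of_forall fun ζ hζ => ?_
      rw [Set.uIoc_of_le h] at hζ
      have hlt : 0 < γ - β := by linarith [hζ.1, hζ.2]
      have := hUconv β γ αm hβ hγ ((ζ - β) / (γ - β))
        ⟨div_nonneg (by linarith [hζ.1]) hlt.le, by
          rw [div_le_one hlt]; linarith [hζ.2]⟩
      have he : (1 - (ζ - β) / (γ - β)) * β + (ζ - β) / (γ - β) * γ = ζ := by
        field_simp
        ring
      rw [he] at this
      exact hUZ this
    have := hX αm β γ h
    rw [h0] at this
    linarith [this.1, this.2]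
  have key2 : ∀ (αm : Fin d → ℝ) (β γ : ℝ), (β, αm) ∈ U → (γ, αm) ∈ U →
      Xbar₁ (γ, αm) = Xbar₁ (β, αm) := by
    intro αm β γ hβ hγ
    rcases le_total β γ with h | h
    · exact key αm β γ h hβ hγ
    · exact (key αm γ β h hγ hβ).symm
  ext p
  constructor
  · rintro ⟨⟨x, y⟩, hxy, rfl⟩
    have hy : y ∈ Um := by rw [hUm]; exact ⟨x, hxy⟩
    refine ⟨y, hy, ?_⟩
    rw [hXform]
    simp only [key2 y x (f y) hxy (hgraph y hy)]
  · rintro ⟨y, hy, rfl⟩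
    exact ⟨(f y, y), hgraph y hy, hXform _⟩
end

section
/- Let d ≥ 1 and let λ denote Lebesgue measure (on ℝ × ℝ^d, on ℝ^d, or on ℝ, as appropriate). Let Z ⊆ ℝ × ℝ^d be a Borel set such that for every α₋ ∈ ℝ^d the slice Z_{α₋} := {α₁ ∈ ℝ : (α₁, α₋) ∈ Z} is either empty or a compact interval. Let X̄ : ℝ × ℝ^d → ℝ × ℝ^d be Borel measurable of the form X̄(α₁, α₋) = (X̄₁(α₁, α₋), α₋), and suppose there is a Borel measurable g : ℝ^d → ℝ such that X̄₁(α₁, α₋) = g(α₋) for every (α₁, α₋) ∈ Z. Let ρ₀ : ℝ × ℝ^d → [0,∞) be Lebesgue integrable, and define c(α₋) := ∫_{Z_{α₋}} ρ₀(α₁, α₋) dα₁ and T : ℝ^d → ℝ × ℝ^d by T(α₋) := (g(α₋), α₋). Then the pushforward X̄♯(ρ₀·1_Z·λ) equals the pushforward under T of the measure on ℝ^d with density c with respect to λ; that is, the concentrated part of the limiting mass disintegrates as dμ̄_Z(x₁, α₋) = c(α₋)·δ_{g(α₋)}(x₁) dα₋. -/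
open MeasureTheory

/-- Theorem 1.4 (t:Xreg), second part: when the zero set `Z` has (empty or) compact-interval
slices and the limiting flow map is constant equal to `g(αm)` in the `x₁`-variable on each
slice, the concentrated part `X̄♯(ρ₀·1_Z·λ)` of the limiting mass disintegrates as
`c(αm)·δ_{g(αm)}(x₁) dαm`, i.e., it is the pushforward under `T(αm) = (g(αm), αm)` of the
measure with density `c(αm) = ∫_{Z_{αm}} ρ₀(α₁, αm) dα₁`. -/
theorem stmt_9 (d : ℕ) (hd : 1 ≤ d)
    (Z : Set (ℝ × (Fin d → ℝ))) (hZmeas : MeasurableSet Z)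
    (hslice : ∀ αm : Fin d → ℝ, {α₁ : ℝ | (α₁, αm) ∈ Z} = ∅ ∨
      ∃ u v : ℝ, u ≤ v ∧ {α₁ : ℝ | (α₁, αm) ∈ Z} = Set.Icc u v)
    (Xbar₁ : ℝ × (Fin d → ℝ) → ℝ)
    (Xbar : ℝ × (Fin d → ℝ) → ℝ × (Fin d → ℝ))
    (hXform : ∀ α, Xbar α = (Xbar₁ α, α.2))
    (hXmeas : Measurable Xbar)
    (g : (Fin d → ℝ) → ℝ) (hg : Measurable g)
    (hXZ : ∀ α ∈ Z, Xbar₁ α = g α.2)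
    (ρ₀ : ℝ × (Fin d → ℝ) → ℝ) (hρ₀ : ∀ α, 0 ≤ ρ₀ α) (hρint : Integrable ρ₀) :
    Measure.map Xbar ((volume.restrict Z).withDensity (fun α => ENNReal.ofReal (ρ₀ α))) =
      Measure.map (fun αm : Fin d → ℝ => (g αm, αm))
        (volume.withDensity
          (fun αm => ENNReal.ofReal (∫ α₁ in {α₁ : ℝ | (α₁, αm) ∈ Z}, ρ₀ (α₁, αm)))) := by
  have hT : Measurable (fun αm : Fin d → ℝ => (g αm, αm)) := hg.prodMk measurable_id
  ext A hA
  rw [Measure.map_apply hXmeas hA, Measure.map_apply hT hA,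
    withDensity_apply _ (hXmeas hA), withDensity_apply _ (hT hA),
    Measure.restrict_restrict (hXmeas hA)]
  have hset : Xbar ⁻¹' A ∩ Z =
      (Prod.snd ⁻¹' ((fun αm : Fin d → ℝ => (g αm, αm)) ⁻¹' A)) ∩ Z := by
    ext α
    simp only [Set.mem_inter_iff, Set.mem_preimage]
    refine and_congr_left fun h => ?_
    rw [hXform, hXZ α h]
  rw [hset]
  set B := (fun αm : Fin d → ℝ => (g αm, αm)) ⁻¹' A with hB
  have hBm : MeasurableSet B := hT hA
  have hm : MeasurableSet ((Prod.snd ⁻¹' B : Set (ℝ × (Fin d → ℝ))) ∩ Z) :=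
    (measurable_snd hBm).inter hZmeas
  rw [← lintegral_indicator hm, ← lintegral_indicator hBm]
  have hae : AEMeasurable (fun α => ENNReal.ofReal (ρ₀ α)) (volume : Measure (ℝ × (Fin d → ℝ))) :=
    hρint.aestronglyMeasurable.aemeasurable.ennreal_ofReal
  rw [Measure.volume_eq_prod] at hae hρint ⊢
  rw [lintegral_prod_symm _ (hae.indicator hm)]
  refine lintegral_congr_ae ?_
  filter_upwards [hρint.prod_left_ae] with y hy
  have hS : MeasurableSet {x : ℝ | (x, y) ∈ Z} := measurable_prodMk_right hZmeas
  by_cases hyB : y ∈ B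
  · rw [Set.indicator_of_mem hyB,
      ofReal_integral_eq_lintegral_ofReal hy.restrict (Filter.Eventually.of_forall fun x => hρ₀ _),
      ← lintegral_indicator hS]
    refine lintegral_congr fun x => ?_
    by_cases hx : (x, y) ∈ Z
    · rw [Set.indicator_of_mem (show (x, y) ∈ Prod.snd ⁻¹' B ∩ Z from ⟨hyB, hx⟩),
        Set.indicator_of_mem (show x ∈ {x : ℝ | (x, y) ∈ Z} from hx)]
    · rw [Set.indicator_of_notMem (fun h => hx h.2),
        Set.indicator_of_notMem (show x ∉ {x : ℝ | (x, y) ∈ Z} from hx)]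
  · rw [Set.indicator_of_notMem hyB]
    simp [Set.indicator, hyB]
end

section
/- Fix γ ∈ (0, 1/3) and define lengths ℓ₀ = 1 and ℓ_{j+1} = (ℓ_j − γ^{j+1})/2. Define the level-j intervals recursively: the unique level-0 interval is [0,1], and each level-j interval [u, u + ℓ_j] produces the two level-(j+1) intervals [u, u + ℓ_{j+1}] and [u + ℓ_{j+1} + γ^{j+1}, u + ℓ_j] (i.e., the open concentric middle interval of length γ^{j+1} is removed). Let Z_j be the union of the 2^j level-j intervals and let Z := ⋂_j Z_j (a Cantor-type set of Lebesgue measure (1 − 3γ)/(1 − 2γ) > 0). Let β ∈ (0,1), and let F : [0,1] → ℝ be continuous and nondecreasing such that there are constants 0 < c₁ ≤ c₂ with c₁·(βγ)^j ≤ F(v) − F(u) ≤ c₂·(βγ)^j for every level-j interval [u, v]. Then the Hausdorff dimension of the image F(Z) equals (log 2)/(log(1/(βγ))). -/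
/-- The lengths `ℓ_j` of the level-`j` intervals of the Cantor-type construction:
`ℓ_0 = 1`, `ℓ_{j+1} = (ℓ_j − γ^{j+1})/2`. -/
noncomputable def ell (γ : ℝ) : ℕ → ℝ
  | 0 => 1
  | j + 1 => (ell γ j - γ ^ (j + 1)) / 2

/-- `IsLevelInterval γ j u v` says that `[u, v]` is one of the `2^j` level-`j` intervals of the
Cantor-type construction: the level-0 interval is `[0,1]`, and each level-`j` interval
`[u, u + ℓ_j]` produces the two level-`(j+1)` intervals `[u, u + ℓ_{j+1}]` and
`[u + ℓ_{j+1} + γ^{j+1}, u + ℓ_j]` (the open concentric middle interval of length `γ^{j+1}`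
being removed). -/
inductive IsLevelInterval (γ : ℝ) : ℕ → ℝ → ℝ → Prop
  | zero : IsLevelInterval γ 0 0 1
  | left {j : ℕ} {u v : ℝ} : IsLevelInterval γ j u v →
      IsLevelInterval γ (j + 1) u (u + ell γ (j + 1))
  | right {j : ℕ} {u v : ℝ} : IsLevelInterval γ j u v →
      IsLevelInterval γ (j + 1) (u + ell γ (j + 1) + γ ^ (j + 1)) v

open MeasureTheory Set Filter Topology
open scoped ENNReal NNReal

noncomputable def lpts (γ : ℝ) : ℕ → Finset ℝ
  | 0 => {0}
  | j + 1 => lpts γ j ∪ (lpts γ j).image (fun u => u + ell γ (j + 1) + γ ^ (j + 1))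

theorem lpts_card (γ : ℝ) (j : ℕ) : (lpts γ j).card ≤ 2 ^ j := by
  induction j with
  | zero => simp [lpts]
  | succ j ih =>
    rw [lpts]
    refine (Finset.card_union_le _ _).trans ?_
    have := Finset.card_image_le (s := lpts γ j) (f := fun u => u + ell γ (j + 1) + γ ^ (j + 1))
    have h2 : 2 ^ (j + 1) = 2 ^ j * 2 := pow_succ 2 j
    omega

theorem ell_split (γ : ℝ) (j : ℕ) : ell γ j = 2 * ell γ (j + 1) + γ ^ (j + 1) := by
  rw [ell]; ring

theorem level_iff (γ : ℝ) (j : ℕ) (u v : ℝ) :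
    IsLevelInterval γ j u v ↔ u ∈ lpts γ j ∧ v = u + ell γ j := by
  constructor
  · intro h
    induction h with
    | zero => simp [lpts, ell]
    | left h ih => exact ⟨by rw [lpts]; exact Finset.mem_union_left _ ih.1, rfl⟩
    | @right j u v h ih =>
      refine ⟨by rw [lpts]; exact Finset.mem_union_right _ (Finset.mem_image_of_mem _ ih.1), ?_⟩
      rw [ih.2, ell_split γ j]; ring
  · rintro ⟨h, rfl⟩
    induction j generalizing u with
    | zero =>
      simp only [lpts, Finset.mem_singleton] at h
      subst h
      simpa [ell] using IsLevelInterval.zero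
    | succ j ih =>
      rw [lpts, Finset.mem_union, Finset.mem_image] at h
      rcases h with h | ⟨w, hw, rfl⟩
      · exact (ih u h).left
      · have := (ih w hw).right
        convert this using 1
        rw [ell_split γ j]; ring

theorem ell_ge {γ : ℝ} (hγ : γ ∈ Ioo (0:ℝ) (1/3)) (j : ℕ) : γ ^ j ≤ ell γ j := by
  induction j with
  | zero => simp [ell]
  | succ j ih =>
    rw [ell]
    have : 0 < γ ^ j := pow_pos hγ.1 j
    have h2 := hγ.2
    rw [pow_succ]
    nlinarith

theorem ell_pos {γ : ℝ} (hγ : γ ∈ Ioo (0:ℝ) (1/3)) (j : ℕ) : 0 < ell γ j :=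
  (pow_pos hγ.1 j).trans_le (ell_ge hγ j)

theorem ell_le {γ : ℝ} (hγ : γ ∈ Ioo (0:ℝ) (1/3)) (j : ℕ) : ell γ j ≤ (1/2) ^ j := by
  induction j with
  | zero => simp [ell]
  | succ j ih =>
    rw [ell]
    have : 0 < γ ^ (j+1) := pow_pos hγ.1 _
    rw [pow_succ (1/2 : ℝ)]
    linarith

theorem lpts_bd {γ : ℝ} (hγ : γ ∈ Ioo (0:ℝ) (1/3)) (j : ℕ) :
    ∀ u ∈ lpts γ j, 0 ≤ u ∧ u + ell γ j ≤ 1 := by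
  induction j with
  | zero => simp [lpts, ell]
  | succ j ih =>
    intro u hu
    have h1 := ell_pos hγ (j+1)
    have h2 : 0 < γ ^ (j+1) := pow_pos hγ.1 _
    have h3 := ell_split γ j
    rw [lpts, Finset.mem_union, Finset.mem_image] at hu
    rcases hu with h | ⟨w, hw, rfl⟩
    · have := ih u h
      constructor <;> linarith
    · have := ih w hw
      constructor <;> linarith

def cset (γ : ℝ) : Set ℝ := ⋂ j : ℕ, ⋃ u ∈ lpts γ j, Icc u (u + ell γ j)

theorem cset_eq (γ : ℝ) :
    (⋂ j : ℕ, ⋃ u : ℝ, ⋃ v : ℝ, ⋃ _ : IsLevelInterval γ j u v, Set.Icc u v) = cset γ := by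
  ext x
  simp only [cset, mem_iInter, mem_iUnion, level_iff, exists_prop]
  refine forall_congr' fun j => ⟨?_, ?_⟩
  · rintro ⟨u, v, ⟨h, rfl⟩, hx⟩
    exact ⟨u, h, hx⟩
  · rintro ⟨u, h, hx⟩
    exact ⟨u, _, ⟨h, rfl⟩, hx⟩

theorem cset_sub {γ : ℝ} : cset γ ⊆ Icc 0 1 := by
  intro x hx
  have := mem_iInter.1 hx 0
  simpa [lpts, ell] using this

theorem unit_cover (γ : ℝ) : Icc (0:ℝ) 1 ⊆ cset γ ∪ ⋃ j : ℕ, ⋃ u ∈ lpts γ j,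
    Icc (u + ell γ (j+1)) (u + ell γ (j+1) + γ ^ (j+1)) := by
  intro x hx
  by_contra hcon
  rw [mem_union, not_or] at hcon
  obtain ⟨h1, h2⟩ := hcon
  apply h1
  refine mem_iInter.2 fun j => ?_
  induction j with
  | zero => simpa [lpts, ell] using hx
  | succ j ih =>
    simp only [mem_iUnion, exists_prop, not_exists, not_and] at ih h2 ⊢
    obtain ⟨u, hu, hxu⟩ := ih
    have h3 := h2 j u hu
    have h4 := ell_split γ j
    rw [mem_Icc] at hxu
    by_cases ha : x ≤ u + ell γ (j+1)
    · exact ⟨u, by rw [lpts]; exact Finset.mem_union_left _ hu, hxu.1, ha⟩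
    · refine ⟨u + ell γ (j + 1) + γ ^ (j + 1), by
        rw [lpts]; exact Finset.mem_union_right _ (Finset.mem_image_of_mem _ hu), ?_, ?_⟩
      · by_contra hb
        exact h3 ⟨by linarith, by linarith⟩
      · linarith

theorem vol_cset_pos {γ : ℝ} (hγ : γ ∈ Ioo (0:ℝ) (1/3)) : volume (cset γ) ≠ 0 := by
  intro h0
  obtain ⟨hg0, hg1⟩ := hγ
  have h1 : volume (Icc (0:ℝ) 1) ≤ ∑' j : ℕ, ENNReal.ofReal (γ * (2 * γ) ^ j) := by
    refine (measure_mono (unit_cover γ)).trans ((measure_union_le _ _).trans ?_)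
    rw [h0, zero_add]
    refine (measure_iUnion_le _).trans (ENNReal.tsum_le_tsum fun j => ?_)
    refine (measure_biUnion_finset_le _ _).trans ?_
    simp only [Real.volume_Icc, add_sub_cancel_left, Finset.sum_const, nsmul_eq_mul]
    have : ((lpts γ j).card : ℝ≥0∞) ≤ ENNReal.ofReal (2 ^ j) := by
      have h := lpts_card γ j
      rw [← ENNReal.ofReal_natCast]
      exact ENNReal.ofReal_le_ofReal (by exact_mod_cast h)
    refine (mul_le_mul_left this _).trans ?_
    rw [← ENNReal.ofReal_mul (by positivity)]
    refine ENNReal.ofReal_le_ofReal (le_of_eq ?_)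
    rw [mul_pow]; ring
  have hs : HasSum (fun j : ℕ => γ * (2 * γ) ^ j) (γ * (1 - 2 * γ)⁻¹) :=
    (hasSum_geometric_of_lt_one (by linarith) (by linarith)).mul_left _
  rw [← ENNReal.ofReal_tsum_of_nonneg (fun j => by positivity) hs.summable, hs.tsum_eq,
    Real.volume_Icc] at h1
  have h3 : γ * (1 - 2 * γ)⁻¹ < 1 := by
    rw [← div_eq_mul_inv, div_lt_one (by linarith)]; linarith
  rw [ENNReal.ofReal_le_ofReal_iff (by have : 0 < 1 - 2*γ := by linarith
                                       positivity)] at h1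
  linarith

theorem vol_pre {γ ρ c : ℝ} (hγ : γ ∈ Ioo (0:ℝ) (1/3)) (hρ : 0 < ρ) (hc : 0 < c)
    {F : ℝ → ℝ} (hFmono : MonotoneOn F (Icc 0 1))
    (hF : ∀ j, ∀ u ∈ lpts γ j, 2 * c * ρ ^ j ≤ F (u + ell γ j) - F u)
    (A : Set ℝ) (j : ℕ) (hA : Metric.ediam A ≤ ENNReal.ofReal (c * ρ ^ j)) :
    volume (cset γ ∩ F ⁻¹' A) ≤ 2 * ENNReal.ofReal ((1/2) ^ j) := by
  set S := cset γ ∩ F ⁻¹' A with hS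
  rcases S.eq_empty_or_nonempty with he | hne
  · rw [he]; simp
  have hS01 : S ⊆ Icc 0 1 := inter_subset_left.trans cset_sub
  have hba : BddAbove S := bddAbove_Icc.mono hS01
  have hbb : BddBelow S := bddBelow_Icc.mono hS01
  have hsub : S ⊆ Icc (sInf S) (sInf S + ell γ j) ∪ Icc (sSup S - ell γ j) (sSup S) := by
    intro z hz
    have hz1 := csInf_le hbb hz
    have hz2 := le_csSup hba hz
    have := mem_iInter.1 hz.1 j
    simp only [mem_iUnion, exists_prop] at this
    obtain ⟨u, hu, hzu⟩ := this
    rw [mem_Icc] at hzu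
    by_cases h1 : u ≤ sInf S
    · exact Or.inl ⟨hz1, by linarith⟩
    by_cases h2 : sSup S ≤ u + ell γ j
    · exact Or.inr ⟨by linarith, hz2⟩
    exfalso
    push Not at h1 h2
    obtain ⟨a, ha, hau⟩ := exists_lt_of_csInf_lt hne h1
    obtain ⟨b, hb, hbu⟩ := exists_lt_of_lt_csSup hne h2
    have hub := lpts_bd hγ j u hu
    have hl := ell_pos hγ j
    have e1 := hFmono (hS01 ha) ⟨hub.1, by linarith⟩ hau.le
    have e2 := hFmono ⟨by linarith, hub.2⟩ (hS01 hb) hbu.le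
    have e3 := hF j u hu
    have hpos : 0 < c * ρ ^ j := by positivity
    have e4 : edist (F b) (F a) ≤ ENNReal.ofReal (c * ρ ^ j) :=
      (Metric.edist_le_ediam_of_mem (mem_preimage.1 hb.2) (mem_preimage.1 ha.2)).trans hA
    rw [edist_dist, ENNReal.ofReal_le_ofReal_iff hpos.le, Real.dist_eq] at e4
    have := (le_abs_self _).trans e4
    linarith
  refine (measure_mono hsub).trans ((measure_union_le _ _).trans ?_)
  rw [Real.volume_Icc, Real.volume_Icc, two_mul]
  refine add_le_add (ENNReal.ofReal_le_ofReal ?_) (ENNReal.ofReal_le_ofReal ?_) <;>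
  · have := ell_le hγ j
    linarith

theorem vol_pre' {γ ρ c s : ℝ} (hγ : γ ∈ Ioo (0:ℝ) (1/3)) (hρ : 0 < ρ) (hρ1 : ρ < 1) (hc : 0 < c)
    (hs : 0 < s) (hρs : ρ ^ s = 1/2)
    {F : ℝ → ℝ} (hFmono : MonotoneOn F (Icc 0 1))
    (hF : ∀ j, ∀ u ∈ lpts γ j, 2 * c * ρ ^ j ≤ F (u + ell γ j) - F u)
    (A : Set ℝ) (hA : Metric.ediam A ≤ ENNReal.ofReal c) :
    volume (cset γ ∩ F ⁻¹' A) ≤ ENNReal.ofReal (4 * c⁻¹ ^ s) * Metric.ediam A ^ s := by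
  have key := vol_pre hγ hρ hc hFmono hF A
  have hfin : Metric.ediam A ≠ ⊤ := ne_top_of_le_ne_top ENNReal.ofReal_ne_top hA
  obtain ⟨d, hd⟩ : ∃ d : ℝ≥0, Metric.ediam A = d := ⟨_, (ENNReal.coe_toNNReal hfin).symm⟩
  rw [← ENNReal.ofReal_coe_nnreal] at hd
  rw [hd] at hA key ⊢
  clear hd hfin
  have hd0 : (0:ℝ) ≤ d := d.2
  generalize (d:ℝ) = x at *
  rcases hd0.eq_or_lt with h0 | h0
  · subst h0
    have : Tendsto (fun j : ℕ => 2 * ENNReal.ofReal ((1/2) ^ j)) atTop (𝓝 0) := by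
      have h := (ENNReal.tendsto_ofReal (tendsto_pow_atTop_nhds_zero_of_lt_one
        (r := (1/2:ℝ)) (by norm_num) (by norm_num)))
      have := ENNReal.Tendsto.const_mul (a := 2) h (Or.inr (by simp))
      simpa using this
    refine (ge_of_tendsto' this fun j => key j ?_).trans (zero_le)
    simp
  · rw [ENNReal.ofReal_le_ofReal_iff hc.le] at hA
    obtain ⟨n, hn1, hn2⟩ := exists_nat_pow_near_of_lt_one (x := x / c) (y := ρ) (by positivity)
      (by rwa [div_le_one hc]) hρ hρ1
    rw [div_le_iff₀ hc] at hn2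
    refine (key n (ENNReal.ofReal_le_ofReal (by linarith))).trans ?_
    rw [ENNReal.ofReal_rpow_of_pos h0, ← ENNReal.ofReal_mul (by positivity),
      ← ENNReal.ofReal_ofNat, ← ENNReal.ofReal_mul (by norm_num)]
    apply ENNReal.ofReal_le_ofReal
    have h1 : (ρ ^ (n+1)) ^ s ≤ (x / c) ^ s :=
      Real.rpow_le_rpow (by positivity) hn1.le hs.le
    rw [← Real.rpow_pow_comm hρ.le, hρs, div_eq_mul_inv x c, Real.mul_rpow h0.le (by positivity)] at h1
    rw [pow_succ] at h1
    linarith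

theorem haus_ne_zero {γ ρ c s : ℝ} (hγ : γ ∈ Ioo (0:ℝ) (1/3)) (hρ : 0 < ρ) (hρ1 : ρ < 1)
    (hc : 0 < c) (hs : 0 < s) (hρs : ρ ^ s = 1/2)
    {F : ℝ → ℝ} (hFmono : MonotoneOn F (Icc 0 1))
    (hF : ∀ j, ∀ u ∈ lpts γ j, 2 * c * ρ ^ j ≤ F (u + ell γ j) - F u) :
    μH[s] (F '' cset γ) ≠ 0 := by
  set C := ENNReal.ofReal (4 * c⁻¹ ^ s) with hC
  have hC0 : C ≠ 0 := by
    rw [hC, ne_eq, ENNReal.ofReal_eq_zero, not_le]; positivity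
  have hCt : C ≠ ⊤ := ENNReal.ofReal_ne_top
  let μ : OuterMeasure ℝ := C⁻¹ • OuterMeasure.map F
    (OuterMeasure.restrict (cset γ) (volume : Measure ℝ).toOuterMeasure)
  have hμ : ∀ A, μ A = C⁻¹ * volume (cset γ ∩ F ⁻¹' A) := by
    intro A
    simp [μ, inter_comm]
  have hle : μ ≤ OuterMeasure.mkMetric (fun r => r ^ s) := by
    refine OuterMeasure.le_mkMetric _ μ (ENNReal.ofReal c) (by simpa using hc) fun A hA => ?_
    rw [hμ]
    calc _ ≤ C⁻¹ * (C * Metric.ediam A ^ s) := by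
          gcongr
          exact vol_pre' hγ hρ hρ1 hc hs hρs hFmono hF A hA
      _ = _ := by rw [← mul_assoc, ENNReal.inv_mul_cancel hC0 hCt, one_mul]
  have h1 := hle (F '' cset γ)
  rw [hμ, OuterMeasure.coe_mkMetric] at h1
  intro h0
  have h2 : Measure.mkMetric (fun r => r ^ s) (F '' cset γ) = 0 := h0
  rw [h2, nonpos_iff_eq_zero, inter_eq_self_of_subset_left (subset_preimage_image F _)] at h1
  rcases mul_eq_zero.1 h1 with h | h
  · exact hCt (ENNReal.inv_eq_zero.1 h)
  · exact vol_cset_pos hγ h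

theorem haus_ne_top {γ ρ c s : ℝ} (hγ : γ ∈ Ioo (0:ℝ) (1/3)) (hρ : 0 < ρ) (hρ1 : ρ < 1)
    (hc : 0 < c) (hs : 0 < s) (hρs : ρ ^ s = 1/2)
    {F : ℝ → ℝ} (hFmono : MonotoneOn F (Icc 0 1))
    (hF : ∀ j, ∀ u ∈ lpts γ j, F (u + ell γ j) - F u ≤ c * ρ ^ j) :
    μH[s] (F '' cset γ) ≠ ⊤ := by
  have hdiam : ∀ j, ∀ u ∈ lpts γ j,
      Metric.ediam (F '' Icc u (u + ell γ j)) ≤ ENNReal.ofReal (c * ρ ^ j) := by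
    intro j u hu
    have hub := lpts_bd hγ j u hu
    have hl := ell_pos hγ j
    have hsub : F '' Icc u (u + ell γ j) ⊆ Icc (F u) (F (u + ell γ j)) := by
      rintro _ ⟨x, hx, rfl⟩
      have hx01 : x ∈ Icc (0:ℝ) 1 := ⟨hub.1.trans hx.1, hx.2.trans hub.2⟩
      exact ⟨hFmono ⟨hub.1, by linarith⟩ hx01 hx.1, hFmono hx01 ⟨by linarith, hub.2⟩ hx.2⟩
    refine (Metric.ediam_mono hsub).trans ?_
    rw [Real.ediam_Icc]
    exact ENNReal.ofReal_le_ofReal (hF j u hu)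
  have htend : Tendsto (fun j : ℕ => ENNReal.ofReal (c * ρ ^ j)) atTop (𝓝 0) := by
    have := ENNReal.tendsto_ofReal ((tendsto_pow_atTop_nhds_zero_of_lt_one hρ.le hρ1).const_mul c)
    simpa using this
  have h := Measure.hausdorffMeasure_le_liminf_sum (ι := fun j : ℕ => {u // u ∈ lpts γ j}) s
    (F '' cset γ) (l := atTop) (fun j => ENNReal.ofReal (c * ρ ^ j)) htend
    (fun j u => F '' Icc u.1 (u.1 + ell γ j))
    (Eventually.of_forall fun j u => hdiam j u.1 u.2)
    (Eventually.of_forall fun j => by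
      rintro _ ⟨x, hx, rfl⟩
      have := mem_iInter.1 hx j
      simp only [mem_iUnion, exists_prop] at this
      obtain ⟨u, hu, hxu⟩ := this
      exact mem_iUnion.2 ⟨⟨u, hu⟩, mem_image_of_mem F hxu⟩)
  refine ne_top_of_le_ne_top (ENNReal.ofReal_ne_top (r := c ^ s)) (h.trans ?_)
  refine (liminf_le_liminf (v := fun _ => ENNReal.ofReal (c ^ s))
    (Eventually.of_forall fun j => ?_)).trans (by simp)
  calc _ ≤ ∑ u : {u // u ∈ lpts γ j}, ENNReal.ofReal (c * ρ ^ j) ^ s :=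
        Finset.sum_le_sum fun u _ => ENNReal.rpow_le_rpow (hdiam j u.1 u.2) hs.le
    _ = (lpts γ j).card * ENNReal.ofReal ((c * ρ ^ j) ^ s) := by
        rw [ENNReal.ofReal_rpow_of_pos (by positivity)]
        simp
    _ ≤ ENNReal.ofReal (2 ^ j) * ENNReal.ofReal ((c * ρ ^ j) ^ s) := by
        gcongr
        have h := lpts_card γ j
        rw [← ENNReal.ofReal_natCast]
        exact ENNReal.ofReal_le_ofReal (by exact_mod_cast h)
    _ = ENNReal.ofReal (c ^ s) := by
        rw [← ENNReal.ofReal_mul (by positivity), Real.mul_rpow hc.le (by positivity),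
          ← Real.rpow_pow_comm hρ.le, hρs]
        congr 1
        rw [mul_left_comm, ← mul_pow]
        norm_num

/-- Proposition 5.1 (p:Cantor): if `F` is continuous and nondecreasing on `[0,1]` with
increments over each level-`j` interval comparable to `(βγ)^j`, then the image `F(Z)` of the
Cantor-type set `Z = ⋂_j Z_j` has Hausdorff dimension `log 2 / log(1/(βγ))`. -/
theorem stmt_11 (γ : ℝ) (hγ : γ ∈ Set.Ioo (0:ℝ) (1/3))
    (β : ℝ) (hβ : β ∈ Set.Ioo (0:ℝ) 1)
    (Z : Set ℝ)
    (hZ : Z = ⋂ j : ℕ, ⋃ u : ℝ, ⋃ v : ℝ, ⋃ _ : IsLevelInterval γ j u v, Set.Icc u v)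
    (F : ℝ → ℝ) (hFc : ContinuousOn F (Set.Icc 0 1)) (hFmono : MonotoneOn F (Set.Icc 0 1))
    (c₁ c₂ : ℝ) (hc₁ : 0 < c₁) (hc₁₂ : c₁ ≤ c₂)
    (hF : ∀ j u v, IsLevelInterval γ j u v →
      c₁ * (β * γ) ^ j ≤ F v - F u ∧ F v - F u ≤ c₂ * (β * γ) ^ j) :
    dimH (F '' Z) = ENNReal.ofReal (Real.log 2 / Real.log (1 / (β * γ))) := by
  rw [cset_eq] at hZ
  subst hZ
  have hγ0 := hγ.1
  have hγ1 := hγ.2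
  have hρ : 0 < β * γ := mul_pos hβ.1 hγ0
  have hρ1 : β * γ < 1 := by nlinarith [hβ.1, hβ.2]
  generalize β * γ = ρ at *
  have hlog : 0 < Real.log (1 / ρ) := Real.log_pos (by rw [lt_div_iff₀ hρ]; linarith)
  have hs : 0 < Real.log 2 / Real.log (1 / ρ) := div_pos (Real.log_pos (by norm_num)) hlog
  have hρs : ρ ^ (Real.log 2 / Real.log (1 / ρ)) = 1 / 2 := by
    have e : Real.log (1 / ρ) = - Real.log ρ := by rw [one_div, Real.log_inv]
    rw [Real.rpow_def_of_pos hρ]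
    rw [e] at hlog ⊢
    have : Real.log ρ * (Real.log 2 / -Real.log ρ) = - Real.log 2 := by
      have : Real.log ρ ≠ 0 := by linarith
      field_simp
    rw [this, Real.exp_neg, Real.exp_log (by norm_num)]
    norm_num
  generalize Real.log 2 / Real.log (1 / ρ) = s at *
  have hF1 : ∀ j, ∀ u ∈ lpts γ j, 2 * (c₁ / 2) * ρ ^ j ≤ F (u + ell γ j) - F u := by
    intro j u hu
    have := (hF j u _ ((level_iff γ j u _).2 ⟨hu, rfl⟩)).1
    rwa [mul_div_cancel₀ c₁ (two_ne_zero)]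
  have hF2 : ∀ j, ∀ u ∈ lpts γ j, F (u + ell γ j) - F u ≤ c₂ * ρ ^ j := fun j u hu =>
    (hF j u _ ((level_iff γ j u _).2 ⟨hu, rfl⟩)).2
  have h0 := haus_ne_zero hγ hρ hρ1 (half_pos hc₁) hs hρs hFmono hF1
  have ht := haus_ne_top hγ hρ hρ1 (hc₁.trans_le hc₁₂) hs hρs hFmono hF2
  have e : ((s.toNNReal : ℝ≥0) : ℝ) = s := Real.coe_toNNReal s hs.le
  rw [← e] at h0 ht
  exact dimH_of_hausdorffMeasure_ne_zero_ne_top h0 ht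
end

section
/- Let k ≥ 1 be a natural number and let e₀ : ℝ → ℝ be nonnegative and k times continuously differentiable, with zero set Z := {α ∈ ℝ : e₀(α) = 0}. Assume Z is bounded and every point of Z is an accumulation point of Z. Suppose F : ℝ → ℝ satisfies the two-sided bound: there are constants 0 < a ≤ b such that a·∫_β^γ e₀(ζ) dζ ≤ F(γ) − F(β) ≤ b·∫_β^γ e₀(ζ) dζ for all reals β ≤ γ. Then the Hausdorff dimension of the image F(Z) is at most 1/(k+1). -/
lemma aux_deriv_zero (f : ℝ → ℝ) (S : Set ℝ) (x : ℝ) (hx : x ∈ S) (hf : DifferentiableAt ℝ f x)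
    (h0 : ∀ y ∈ S, f y = 0) (hacc : AccPt x (Filter.principal S)) : deriv f x = 0 := by
  have h1 := hf.hasDerivAt.tendsto_slope
  rw [accPt_iff_frequently_nhdsNE] at hacc
  have := (isClosed_singleton (x := (0:ℝ))).mem_of_frequently_of_tendsto
    (hacc.mono (fun y hy => by simp [slope, h0 y hy, h0 x hx])) h1
  simpa using this

lemma aux_bound (S : Set ℝ) (R : ℝ) (hS : S ⊆ Set.Icc (-R) R)
    (hacc : ∀ x ∈ S, AccPt x (Filter.principal S)) (k : ℕ) :
    ∀ f : ℝ → ℝ, ContDiff ℝ (k : ℕ∞) f → (∀ y ∈ S, f y = 0) →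
      ∃ C : ℝ, 0 ≤ C ∧ ∀ x ∈ S, ∀ y ∈ Set.Icc (-R) R, |f y| ≤ C * |y - x| ^ k := by
  induction k with
  | zero =>
    intro f hf _
    obtain ⟨C, hC⟩ := isCompact_Icc.exists_bound_of_continuousOn
      (hf.continuous.continuousOn (s := Set.Icc (-R) R))
    exact ⟨max C 0, le_max_right _ _, fun x _ y hy => by
      simpa using Or.inl (hC y hy)⟩
  | succ n ih =>
    intro f hf h0
    have hf' : ContDiff ℝ ((n : WithTop ℕ∞) + 1) f := by exact_mod_cast hf
    rw [contDiff_succ_iff_deriv] at hf'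
    obtain ⟨hd, -, hc⟩ := hf'
    obtain ⟨C, hC0, hC⟩ := ih (deriv f) (by exact_mod_cast hc)
      (fun y hy => aux_deriv_zero f S y hy (hd y) h0 (hacc y hy))
    refine ⟨C, hC0, fun x hx y hy => ?_⟩
    have hsub : Set.uIcc x y ⊆ Set.Icc (-R) R := Set.uIcc_subset_Icc (hS hx) hy
    have := (convex_uIcc x y).norm_image_sub_le_of_norm_deriv_le (f := f)
      (C := C * |y - x| ^ n) (fun t _ => hd t) (fun t ht => by
        refine (hC x hx t (hsub ht)).trans ?_
        have := Set.abs_sub_left_of_mem_uIcc ht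
        gcongr) Set.left_mem_uIcc Set.right_mem_uIcc
    rw [h0 x hx, sub_zero, Real.norm_eq_abs, Real.norm_eq_abs] at this
    rw [pow_succ, ← mul_assoc]
    exact this

/-- Theorem 1.5 (t:fineprops), upper bound, Hausdorff-dimension form: if the nonnegative
entropy `e₀` is `C^k`, its zero set `Z` is bounded and perfect (every point an accumulation
point), and the increments of `F` are comparable to integrals of `e₀`, then
`dim_H(F(Z)) ≤ 1/(k+1)`. -/
theorem stmt_12 (k : ℕ) (hk : 1 ≤ k) (e₀ : ℝ → ℝ)
    (he₀ : ∀ α, 0 ≤ e₀ α) (hsmooth : ContDiff ℝ (k : ℕ∞) e₀)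
    (hZbd : Bornology.IsBounded {α : ℝ | e₀ α = 0})
    (hacc : ∀ x ∈ {α : ℝ | e₀ α = 0}, AccPt x (Filter.principal {α : ℝ | e₀ α = 0}))
    (F : ℝ → ℝ) (a b : ℝ) (ha : 0 < a) (hab : a ≤ b)
    (hF : ∀ β γ : ℝ, β ≤ γ →
      a * ∫ ζ in β..γ, e₀ ζ ≤ F γ - F β ∧ F γ - F β ≤ b * ∫ ζ in β..γ, e₀ ζ) :
    dimH (F '' {α : ℝ | e₀ α = 0}) ≤ ENNReal.ofReal (1 / (k + 1)) := by
  obtain ⟨R, hR⟩ := hZbd.subset_closedBall 0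
  rw [Real.closedBall_eq_Icc, zero_sub, zero_add] at hR
  obtain ⟨C, hC0, hC⟩ := aux_bound _ R hR hacc k e₀ hsmooth (fun y hy => hy)
  have hb : 0 < b := ha.trans_le hab
  have key : ∀ x ∈ {α : ℝ | e₀ α = 0}, ∀ y ∈ {α : ℝ | e₀ α = 0}, x ≤ y →
      |F y - F x| ≤ b * C * |y - x| ^ (k + 1) := by
    intro x hx y hy hxy
    have hI : ‖∫ ζ in x..y, e₀ ζ‖ ≤ (C * |y - x| ^ k) * |y - x| := by
      refine intervalIntegral.norm_integral_le_of_norm_le_const (fun t ht => ?_)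
      have ht' : t ∈ Set.uIcc x y := Set.uIoc_subset_uIcc ht
      refine (hC x hx t (Set.uIcc_subset_Icc (hR hx) (hR hy) ht')).trans ?_
      have := Set.abs_sub_left_of_mem_uIcc ht'
      gcongr
    have hnn : 0 ≤ ∫ ζ in x..y, e₀ ζ :=
      intervalIntegral.integral_nonneg hxy (fun t _ => he₀ t)
    obtain ⟨h1, h2⟩ := hF x y hxy
    rw [Real.norm_eq_abs, abs_of_nonneg hnn] at hI
    rw [abs_of_nonneg ((mul_nonneg ha.le hnn).trans h1)]
    calc F y - F x ≤ b * ∫ ζ in x..y, e₀ ζ := h2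
      _ ≤ b * ((C * |y - x| ^ k) * |y - x|) := by gcongr
      _ = _ := by ring
  have hH : HolderOnWith (b * C).toNNReal ((k : NNReal) + 1) F {α : ℝ | e₀ α = 0} := by
    intro x hx y hy
    have h : |F x - F y| ≤ b * C * |x - y| ^ (k + 1) := by
      rcases le_total x y with hxy | hxy
      · rw [abs_sub_comm, abs_sub_comm x y]; exact key x hx y hy hxy
      · exact key y hy x hx hxy
    have e : (((k : NNReal) + 1 : NNReal) : ℝ) = ((k + 1 : ℕ) : ℝ) := by push_cast; rfl
    rw [e, ENNReal.rpow_natCast, edist_dist, edist_dist, Real.dist_eq, Real.dist_eq,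
      ← ENNReal.ofReal_pow (abs_nonneg _)]
    change _ ≤ ENNReal.ofReal (b * C) * _
    rw [← ENNReal.ofReal_mul (by positivity)]
    exact ENNReal.ofReal_le_ofReal h
  refine (hH.dimH_image_le (by positivity)).trans ?_
  have h1 : dimH {α : ℝ | e₀ α = 0} ≤ 1 := by
    rw [← Real.dimH_univ]; exact dimH_mono (Set.subset_univ _)
  rw [ENNReal.ofReal_div_of_pos (by positivity), ENNReal.ofReal_one]
  have e2 : ENNReal.ofReal ((k : ℝ) + 1) = (((k : NNReal) + 1 : NNReal) : ENNReal) := by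
    rw [ENNReal.ofReal_add (by positivity) zero_le_one]; simp
  rw [e2]
  exact ENNReal.div_le_div_right h1 _
end

section
/- Let e₀ : ℝ → ℝ be nonnegative and infinitely differentiable (C^∞), with zero set Z := {α ∈ ℝ : e₀(α) = 0}. Suppose F : ℝ → ℝ satisfies the two-sided bound: there are constants 0 < a ≤ b such that a·∫_β^γ e₀(ζ) dζ ≤ F(γ) − F(β) ≤ b·∫_β^γ e₀(ζ) dζ for all reals β ≤ γ. Then the Hausdorff dimension of the image F(Z) equals 0. -/
open Set Filter Topology in
theorem aux_bound_s13 (C m : ℝ) (x : ℝ) (hx : x ∈ Icc (-m) m) (n : ℕ) :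
    ∀ f : ℝ → ℝ, ContDiff ℝ (⊤ : ℕ∞) f → (∀ k < n, iteratedDeriv k f x = 0) →
    (∀ z ∈ Icc (-m) m, |iteratedDeriv n f z| ≤ C) →
    ∀ y ∈ Icc (-m) m, |f y| ≤ C * |y - x| ^ n := by
  induction n with
  | zero =>
    intro f _ _ hC y hy
    simpa using hC y hy
  | succ n ih =>
    intro f hf h0 hC y hy
    have hC0 : 0 ≤ C := (abs_nonneg _).trans (hC x hx)
    have hf' : ContDiff ℝ (⊤ : ℕ∞) (deriv f) := (contDiff_infty_iff_deriv.1 hf).2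
    have hd : Differentiable ℝ f := (contDiff_infty_iff_deriv.1 hf).1
    have h1 := ih (deriv f) hf' (fun k hk => by
      rw [← iteratedDeriv_succ']; exact h0 (k+1) (by omega)) (fun z hz => by
      rw [← iteratedDeriv_succ']; exact hC z hz)
    have hsub : uIcc x y ⊆ Icc (-m) m := by
      rw [← uIcc_of_le (show -m ≤ m by linarith [hx.1, hx.2])] at *
      exact uIcc_subset_uIcc hx hy
    have h2 := (convex_uIcc x y).norm_image_sub_le_of_norm_deriv_le (f := f)
      (C := C * |y - x| ^ n) (x := x) (y := y) (fun z _ => hd z) (fun z hz => by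
        refine (h1 z (hsub hz)).trans ?_
        gcongr C * ?_ ^ n
        exact abs_sub_left_of_mem_uIcc hz) left_mem_uIcc right_mem_uIcc
    have h00 : f x = 0 := by simpa using h0 0 (by omega)
    rw [h00, sub_zero] at h2
    rw [pow_succ, ← mul_assoc]
    exact h2

open Set Filter Topology in
theorem aux_countable (g : ℝ → ℝ) (hg : Differentiable ℝ g) :
    {x | g x = 0 ∧ deriv g x ≠ 0}.Countable := by
  set S := {x | g x = 0 ∧ deriv g x ≠ 0}
  have : DiscreteTopology S := by
    rw [discreteTopology_subtype_iff]
    intro x hx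
    have h := (hg x).hasDerivAt.eventually_ne (c := 0) hx.2
    rw [inf_principal_eq_bot]
    filter_upwards [h] with z hz hzS
    exact hz hzS.1
  have : Countable S := countable_of_Lindelof_of_discrete
  exact this

/-- Theorem 1.5 (t:fineprops), `C^∞` case: if the nonnegative entropy `e₀` is infinitely
differentiable with zero set `Z`, and the increments of `F` are comparable to integrals of
`e₀`, then the image `F(Z)` has Hausdorff dimension zero. -/
theorem stmt_13 (e₀ : ℝ → ℝ)
    (he₀ : ∀ α, 0 ≤ e₀ α) (hsmooth : ContDiff ℝ (⊤ : ℕ∞) e₀)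
    (F : ℝ → ℝ) (a b : ℝ) (ha : 0 < a) (hab : a ≤ b)
    (hF : ∀ β γ : ℝ, β ≤ γ →
      a * ∫ ζ in β..γ, e₀ ζ ≤ F γ - F β ∧ F γ - F β ≤ b * ∫ ζ in β..γ, e₀ ζ) :
    dimH (F '' {α : ℝ | e₀ α = 0}) = 0 := by
  have hb : 0 < b := ha.trans_le hab
  have key : ∀ n : ℕ, dimH (F '' {α : ℝ | e₀ α = 0}) ≤ ((n : ENNReal) + 1)⁻¹ := by
    intro n
    set D : Set ℝ := {x | ∀ k < n, iteratedDeriv k e₀ x = 0}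
    have hcover : F '' {α : ℝ | e₀ α = 0} ⊆
        (F '' ⋃ k : ℕ, {x | iteratedDeriv k e₀ x = 0 ∧ deriv (iteratedDeriv k e₀) x ≠ 0}) ∪
        ⋃ m : ℕ, F '' (D ∩ Set.Icc (-(m:ℝ)) m) := by
      rintro _ ⟨x, hx, rfl⟩
      by_cases h : ∀ k : ℕ, iteratedDeriv k e₀ x = 0
      · right
        obtain ⟨m, hm⟩ := exists_nat_ge |x|
        exact Set.mem_iUnion.2 ⟨m, x, ⟨fun k _ => h k, abs_le.1 hm⟩, rfl⟩
      · left
        refine ⟨x, ?_, rfl⟩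
        by_contra hcon
        apply h
        intro k
        induction k with
        | zero => simpa using hx
        | succ k ih =>
          by_contra h2
          apply hcon
          refine Set.mem_iUnion.2 ⟨k, ih, ?_⟩
          rwa [← iteratedDeriv_succ]
    refine (dimH_mono hcover).trans ?_
    rw [dimH_union, dimH_iUnion]
    refine max_le ?_ (iSup_le fun m => ?_)
    · rw [dimH_countable]
      · exact zero_le
      · refine (Set.countable_iUnion fun k => aux_countable _ ?_).image F
        exact hsmooth.differentiable_iteratedDeriv k (by exact_mod_cast WithTop.coe_lt_top _)
    · have hc : Continuous (iteratedDeriv n e₀) :=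
        hsmooth.continuous_iteratedDeriv n (by exact_mod_cast le_top)
      obtain ⟨C, hC⟩ := (isCompact_Icc (a := -(m:ℝ)) (b := m)).exists_bound_of_continuousOn
        hc.continuousOn
      have hC0 : 0 ≤ C := (norm_nonneg _).trans (hC 0 (by simp))
      have hle : ∀ x ∈ D ∩ Set.Icc (-(m:ℝ)) m, ∀ y ∈ D ∩ Set.Icc (-(m:ℝ)) m, x ≤ y →
          |F x - F y| ≤ (b * C) * |x - y| ^ (n+1) := by
        intro x hx y hy hxy
        have h1 := aux_bound_s13 C m x hx.2 n e₀ hsmooth hx.1 hC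
        have h2 : ‖∫ ζ in x..y, e₀ ζ‖ ≤ (C * |y - x| ^ n) * |y - x| := by
          apply intervalIntegral.norm_integral_le_of_norm_le_const
          intro z hz
          rw [Set.uIoc_of_le hxy] at hz
          refine (h1 z ⟨hx.2.1.trans hz.1.le, hz.2.trans hy.2.2⟩).trans ?_
          gcongr C * ?_ ^ n
          rw [abs_of_nonneg (by linarith [hz.1]), abs_of_nonneg (by linarith)]
          linarith [hz.2]
        have h3 : 0 ≤ ∫ ζ in x..y, e₀ ζ :=
          intervalIntegral.integral_nonneg hxy fun z _ => he₀ z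
        rw [Real.norm_of_nonneg h3] at h2
        obtain ⟨h4, h5⟩ := hF x y hxy
        rw [abs_sub_comm, abs_of_nonneg ((mul_nonneg ha.le h3).trans h4), abs_sub_comm x]
        calc _ ≤ _ := h5
          _ ≤ b * ((C * |y - x| ^ n) * |y - x|) := by gcongr
          _ = _ := by ring
      have hle' : ∀ x ∈ D ∩ Set.Icc (-(m:ℝ)) m, ∀ y ∈ D ∩ Set.Icc (-(m:ℝ)) m,
          |F x - F y| ≤ (b * C) * |x - y| ^ (n+1) := by
        intro x hx y hy
        rcases le_total x y with h | h
        · exact hle x hx y hy h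
        · rw [abs_sub_comm, abs_sub_comm x]; exact hle y hy x hx h
      have hH : HolderOnWith (b * C).toNNReal ((n : NNReal) + 1) F
          (D ∩ Set.Icc (-(m:ℝ)) m) := by
        intro x hx y hy
        have h := hle' x hx y hy
        rw [edist_dist, edist_dist, Real.dist_eq, Real.dist_eq]
        have : (((n : NNReal) + 1 : NNReal) : ℝ) = ((n + 1 : ℕ) : ℝ) := by push_cast; rfl
        rw [this, ENNReal.rpow_natCast, ← ENNReal.ofReal_pow (abs_nonneg _)]
        change _ ≤ ENNReal.ofReal (b * C) * _
        rw [← ENNReal.ofReal_mul (by positivity)]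
        exact ENNReal.ofReal_le_ofReal h
      refine (hH.dimH_image_le (by positivity)).trans ?_
      have h1 : dimH (D ∩ Set.Icc (-(m:ℝ)) m) ≤ 1 :=
        (dimH_mono (Set.subset_univ _)).trans Real.dimH_univ.le
      calc _ ≤ 1 / (((n : NNReal) + 1 : NNReal) : ENNReal) := by gcongr
        _ = _ := by simp
  refine le_antisymm ?_ zero_le
  refine ge_of_tendsto' (f := fun n : ℕ => ((n : ENNReal) + 1)⁻¹) (x := Filter.atTop) ?_ key
  have := (Filter.tendsto_add_atTop_iff_nat 1).2 ENNReal.tendsto_inv_nat_nhds_zero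
  simpa using this
end

section
/- Let p > 1, δ > 0, and constants 0 < a ≤ b. Let e₀ : ℝ → ℝ be continuous and nonnegative with e₀(α) = p·|α|^{p−1} for all |α| ≤ δ. Let ρ₀ : ℝ → [0,∞) be Lebesgue integrable with ρ₀(α) = 1 for all α ∈ (−δ, δ). Let F : ℝ → ℝ be an odd function satisfying the two-sided bound a·∫_β^γ e₀(ζ) dζ ≤ F(γ) − F(β) ≤ b·∫_β^γ e₀(ζ) dζ for all reals β ≤ γ, and let m̄ := F♯(ρ₀·λ) be the pushforward under F of the measure with density ρ₀ with respect to Lebesgue measure λ. Then log(m̄((−r, r)))/log r converges to 1/p as r → 0⁺; that is, the local dimension of m̄ at the point 0 equals 1/p. -/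
open MeasureTheory

/-- The final Proposition of Section 5: for an odd limiting flow map `F` whose increments are
comparable to integrals of the power-law entropy `e₀(α) = p|α|^{p−1}` near the origin, with
density `ρ₀ = 1` near the origin, the limiting measure `m̄ = F♯(ρ₀·λ)` has local dimension
`1/p` at `0`: `log(m̄((−r,r)))/log r → 1/p` as `r → 0⁺`. -/
theorem stmt_16 (p δ a b : ℝ) (hp : 1 < p) (hδ : 0 < δ) (ha : 0 < a) (hab : a ≤ b)
    (e₀ : ℝ → ℝ) (he₀c : Continuous e₀) (he₀ : ∀ α, 0 ≤ e₀ α)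
    (he₀loc : ∀ α : ℝ, |α| ≤ δ → e₀ α = p * |α| ^ (p - 1))
    (ρ₀ : ℝ → ℝ) (hρ₀ : ∀ α, 0 ≤ ρ₀ α) (hρint : Integrable ρ₀)
    (hρloc : ∀ α ∈ Set.Ioo (-δ) δ, ρ₀ α = 1)
    (F : ℝ → ℝ) (hodd : ∀ x : ℝ, F (-x) = -F x)
    (hF : ∀ β γ : ℝ, β ≤ γ →
      a * ∫ ζ in β..γ, e₀ ζ ≤ F γ - F β ∧ F γ - F β ≤ b * ∫ ζ in β..γ, e₀ ζ) :
    Filter.Tendsto (fun r : ℝ =>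
        Real.log ((Measure.map F (volume.withDensity fun α => ENNReal.ofReal (ρ₀ α)))
          (Set.Ioo (-r) r)).toReal / Real.log r)
      (nhdsWithin 0 (Set.Ioi 0)) (nhds (1 / p)) := by
  
  have hp0 : 0 < p := by linarith
  have hb : 0 < b := by linarith
  have hF0 : F 0 = 0 := by
    have := hodd 0
    rw [neg_zero] at this
    linarith
  have hmono : Monotone F := by
    intro x y hxy
    have h1 := (hF x y hxy).1
    have h2 : 0 ≤ ∫ ζ in x..y, e₀ ζ := intervalIntegral.integral_nonneg hxy (fun u _ => he₀ u)
    have h3 := mul_nonneg ha.le h2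
    linarith
  have hint : ∀ x, 0 ≤ x → x ≤ δ → ∫ ζ in (0:ℝ)..x, e₀ ζ = x ^ p := by
    intro x hx hxd
    have h1 : ∫ ζ in (0:ℝ)..x, e₀ ζ = ∫ ζ in (0:ℝ)..x, p * ζ ^ (p - 1) := by
      apply intervalIntegral.integral_congr
      intro ζ hζ
      rw [Set.uIcc_of_le hx] at hζ
      have h2 : |ζ| = ζ := abs_of_nonneg hζ.1
      have h3 := he₀loc ζ (by rw [h2]; linarith [hζ.2])
      rw [h2] at h3
      exact h3
    rw [h1, intervalIntegral.integral_const_mul, integral_rpow (Or.inl (by linarith))]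
    have h4 : p - 1 + 1 = p := by ring
    rw [h4, Real.zero_rpow hp0.ne']
    field_simp
    ring
  have hlow : ∀ x, 0 ≤ x → x ≤ δ → a * x ^ p ≤ F x := by
    intro x hx hxd
    have := (hF 0 x hx).1
    rw [hint x hx hxd, hF0] at this
    linarith
  have hupp : ∀ x, 0 ≤ x → x ≤ δ → F x ≤ b * x ^ p := by
    intro x hx hxd
    have := (hF 0 x hx).2
    rw [hint x hx hxd, hF0] at this
    linarith
  have habs : ∀ x, |F x| = F |x| := by
    intro x
    rcases le_total 0 x with h | h
    · have := hmono h
      rw [abs_of_nonneg h, abs_of_nonneg (by linarith)]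
    · have := hmono h
      rw [abs_of_nonpos h, abs_of_nonpos (by linarith), hodd]
  set μ := volume.withDensity fun α => ENNReal.ofReal (ρ₀ α) with hμ
  have hμI : ∀ s, 0 < s → s ≤ δ → μ (Set.Ioo (-s) s) = ENNReal.ofReal (2 * s) := by
    intro s hs hsd
    rw [hμ, withDensity_apply _ measurableSet_Ioo,
      setLIntegral_congr_fun (g := fun _ => 1) measurableSet_Ioo]
    · rw [setLIntegral_const, Real.volume_Ioo, one_mul]
      congr 1
      ring
    · intro x hx
      have := hρloc x ⟨by linarith [hx.1], by linarith [hx.2]⟩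
      simp [this]
  have hpow : ∀ c r : ℝ, 0 < c → 0 < r → c * ((r / c) ^ (1 / p)) ^ p = r := by
    intro c r hc hr
    rw [← Real.rpow_mul (by positivity), one_div_mul_cancel hp0.ne', Real.rpow_one]
    field_simp
  have hkey : ∀ r, 0 < r → r < a * δ ^ p →
      2 * (r / b) ^ (1 / p) ≤ ((Measure.map F μ) (Set.Ioo (-r) r)).toReal ∧
      ((Measure.map F μ) (Set.Ioo (-r) r)).toReal ≤ 2 * (r / a) ^ (1 / p) := by
    intro r hr hrd
    rw [Measure.map_apply hmono.measurable measurableSet_Ioo]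
    have hsa : 0 < (r / a) ^ (1 / p) := by positivity
    have hsb : 0 < (r / b) ^ (1 / p) := by positivity
    have hsab : (r / b) ^ (1 / p) ≤ (r / a) ^ (1 / p) := by gcongr
    have hpa := hpow a r ha hr
    have hpb := hpow b r hb hr
    have hsad : (r / a) ^ (1 / p) ≤ δ := by
      by_contra! h
      have := Real.rpow_lt_rpow hδ.le h hp0
      have := mul_lt_mul_of_pos_left this ha
      linarith
    generalize (r / a) ^ (1 / p) = sa at *
    generalize (r / b) ^ (1 / p) = sb at *
    have hU : μ (F ⁻¹' Set.Ioo (-r) r) ≤ μ (Set.Ioo (-sa) sa) := by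
      apply measure_mono
      intro x hx
      have hx' : |F x| < r := abs_lt.2 hx
      rw [habs] at hx'
      apply abs_lt.1
      by_contra! h
      have h1 := hmono h
      have h2 := hlow sa hsa.le hsad
      linarith
    have hL : μ (Set.Ioo (-sb) sb) ≤ μ (F ⁻¹' Set.Ioo (-r) r) := by
      apply measure_mono
      intro x hx
      have hx' : |x| < sb := abs_lt.2 hx
      apply abs_lt.1
      rw [habs]
      have h1 := hupp |x| (abs_nonneg x) (by linarith)
      have h2 := Real.rpow_lt_rpow (abs_nonneg x) hx' hp0
      have h3 := mul_lt_mul_of_pos_left h2 hb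
      linarith
    rw [hμI sa hsa hsad] at hU
    rw [hμI sb hsb (by linarith)] at hL
    constructor
    · have := ENNReal.toReal_mono (ne_top_of_le_ne_top ENNReal.ofReal_ne_top hU) hL
      rwa [ENNReal.toReal_ofReal (by positivity)] at this
    · have := ENNReal.toReal_mono ENNReal.ofReal_ne_top hU
      rwa [ENNReal.toReal_ofReal (by positivity)] at this
  have hlim : ∀ c : ℝ, 0 < c → Filter.Tendsto
      (fun r : ℝ => Real.log (2 * (r / c) ^ (1 / p)) / Real.log r)
      (nhdsWithin 0 (Set.Ioi 0)) (nhds (1 / p)) := by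
    intro c hc
    have h1 : Filter.Tendsto (fun r : ℝ => (Real.log r)⁻¹) (nhdsWithin 0 (Set.Ioi 0))
        (nhds 0) := Filter.Tendsto.inv_tendsto_atBot Real.tendsto_log_nhdsGT_zero
    have h2 := (h1.const_mul (Real.log 2 - 1 / p * Real.log c)).const_add (1 / p)
    rw [mul_zero, add_zero] at h2
    refine h2.congr' ?_
    filter_upwards [Ioo_mem_nhdsGT (zero_lt_one (α := ℝ))] with r hr
    have hr0 : 0 < r := hr.1
    have hlog : Real.log r ≠ 0 := (Real.log_neg hr.1 hr.2).ne
    rw [Real.log_mul (by norm_num) (by positivity), Real.log_rpow (by positivity),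
      Real.log_div hr0.ne' hc.ne']
    field_simp
    ring
  have hpos : 0 < min 1 (a * δ ^ p) := by positivity
  refine tendsto_of_tendsto_of_tendsto_of_le_of_le' (hlim a ha) (hlim b hb) ?_ ?_
  · filter_upwards [Ioo_mem_nhdsGT hpos] with r hr
    have hr0 : 0 < r := hr.1
    obtain ⟨h1, h2⟩ := hkey r hr.1 (hr.2.trans_le (min_le_right _ _))
    have hlog : Real.log r < 0 := Real.log_neg hr.1 (hr.2.trans_le (min_le_left _ _))
    have h0 : 0 < 2 * (r / b) ^ (1 / p) := by positivity
    exact div_le_div_of_nonpos_of_le hlog.le (Real.log_le_log (by linarith) h2)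
  · filter_upwards [Ioo_mem_nhdsGT hpos] with r hr
    have hr0 : 0 < r := hr.1
    obtain ⟨h1, h2⟩ := hkey r hr.1 (hr.2.trans_le (min_le_right _ _))
    have hlog : Real.log r < 0 := Real.log_neg hr.1 (hr.2.trans_le (min_le_left _ _))
    have h0 : 0 < 2 * (r / b) ^ (1 / p) := by positivity
    exact div_le_div_of_nonpos_of_le hlog.le (Real.log_le_log h0 h1)
end

section
/- Let n ≥ 1, let Ω ⊆ ℝⁿ be compact, let κ > 0, and let m₀ be a finite Borel measure supported in Ω with total mass M₀ > 0. Let Φ : [0,∞) → (0,∞) be continuous and nonincreasing with ∫₀^∞ Φ(r) dr = ∞, and set φ(x) := Φ(|x|). Suppose X, V : Ω × [0,∞) → ℝⁿ are continuous, for each α ∈ Ω the maps t ↦ X(α,t) and t ↦ V(α,t) are C¹, and they satisfy ∂ₜX(α,t) = V(α,t) and ∂ₜV(α,t) = −κ·∫_Ω φ(X(α,t) − X(γ,t))·(V(α,t) − V(γ,t)) dm₀(γ) for all t ≥ 0, with X(α,0) = α. Define the diameter D(t) := sup_{α,β ∈ Ω} |X(α,t) − X(β,t)| and the velocity amplitude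 A(t) := sup_{α,β ∈ Ω} |V(α,t) − V(β,t)|. Then there exists a finite constant D̄ such that D(t) ≤ D̄ for all t ≥ 0 and A(t) ≤ A(0)·exp(−κ M₀ Φ(D̄) t) for all t ≥ 0. -/
open MeasureTheory

lemma barrier_aux (A B B' c : ℝ → ℝ) (hAc : ContinuousOn A (Set.Ici 0))
    (hB : ∀ t ≥ (0:ℝ), HasDerivWithinAt B (B' t) (Set.Ici 0) t) (h0 : A 0 < B 0)
    (key : ∀ t ≥ (0:ℝ), ∃ (f : ℝ → ℝ) (f' : ℝ), HasDerivWithinAt f f' (Set.Ici 0) t ∧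
      f t = A t ∧ (∀ s ≥ (0:ℝ), f s ≤ A s) ∧ f' ≤ c t)
    (hlt : ∀ t ≥ (0:ℝ), A t = B t → c t < B' t) : ∀ t ≥ (0:ℝ), A t ≤ B t := by
  intro T hT
  by_contra! hcon
  have hBc : ContinuousOn B (Set.Ici 0) := fun t ht => (hB t ht).continuousWithinAt
  have hsub : Set.Icc 0 T ⊆ Set.Ici (0:ℝ) := fun x hx => hx.1
  have hScl : IsClosed {t ∈ Set.Icc 0 T | B t ≤ A t} :=
    isClosed_Icc.isClosed_le (hBc.mono hsub) (hAc.mono hsub)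
  have hSc : IsCompact {t ∈ Set.Icc 0 T | B t ≤ A t} :=
    isCompact_Icc.of_isClosed_subset hScl (fun x hx => hx.1)
  obtain ⟨t1, ht1, hmin⟩ := hSc.exists_isLeast ⟨T, ⟨hT, le_rfl⟩, hcon.le⟩
  have hpos : 0 < t1 := by
    rcases ht1.1.1.lt_or_eq with h | h
    · exact h
    · exfalso
      have := ht1.2
      rw [← h] at this
      linarith
  have hless : ∀ s, 0 ≤ s → s < t1 → A s < B s := by
    intro s hs hst
    by_contra! h
    exact absurd (hmin ⟨⟨hs, hst.le.trans ht1.1.2⟩, h⟩) (not_le.2 hst)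
  have hnb : Set.Ici (0:ℝ) ∈ nhds t1 := Ici_mem_nhds hpos
  have hev : ∀ᶠ s in nhdsWithin t1 (Set.Iio t1), 0 ≤ s ∧ s < t1 := by
    filter_upwards [mem_nhdsWithin_of_mem_nhds hnb, self_mem_nhdsWithin] with s h1 h2
    exact ⟨h1, h2⟩
  have hle : A t1 ≤ B t1 := by
    have ha : Filter.Tendsto A (nhdsWithin t1 (Set.Iio t1)) (nhds (A t1)) :=
      (hAc.continuousAt hnb).mono_left nhdsWithin_le_nhds
    have hb : Filter.Tendsto B (nhdsWithin t1 (Set.Iio t1)) (nhds (B t1)) :=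
      (hBc.continuousAt hnb).mono_left nhdsWithin_le_nhds
    refine le_of_tendsto_of_tendsto ha hb ?_
    filter_upwards [hev] with s hs using (hless s hs.1 hs.2).le
  have heq : A t1 = B t1 := le_antisymm hle ht1.2
  obtain ⟨f, f', hf, hft, hfA, hfc⟩ := key t1 hpos.le
  have hg : HasDerivAt (fun s => B s - f s) (B' t1 - f') t1 :=
    ((hB t1 hpos.le).hasDerivAt hnb).sub (hf.hasDerivAt hnb)
  have hgp : 0 < B' t1 - f' := by linarith [hlt t1 hpos.le heq]
  have hsl := (hasDerivAt_iff_tendsto_slope.1 hg).mono_left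
    (nhdsWithin_mono t1 (fun x (hx : x < t1) => hx.ne) : nhdsWithin t1 (Set.Iio t1) ≤ _)
  obtain ⟨s, hs1, hs2⟩ := ((hsl.eventually (lt_mem_nhds hgp)).and hev).exists
  rw [slope_def_field] at hs1
  have h1 := hless s hs2.1 hs2.2
  have h2 := hfA s hs2.1
  have : (B s - f s - (B t1 - f t1)) / (s - t1) ≤ 0 :=
    div_nonpos_of_nonneg_of_nonpos (by linarith) (by linarith [hs2.2])
  linarith

lemma sup_cont_aux {E : Type*} [NormedAddCommGroup E] (Ω : Set E) (hΩ : IsCompact Ω)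
    (V : E → ℝ → E)
    (hVc : ContinuousOn (fun q : E × ℝ => V q.1 q.2) (Ω ×ˢ Set.Ici 0)) (A : ℝ → ℝ)
    (hA : ∀ t, A t = sSup ((fun q : E × E => ‖V q.1 t - V q.2 t‖) '' (Ω ×ˢ Ω))) :
    Continuous (fun t => A (max t 0)) := by
  have : CompactSpace Ω := isCompact_iff_compactSpace.1 hΩ
  have hv : Continuous (fun p : Ω × ℝ => V p.1 (max p.2 0)) := by
    have : Continuous (fun p : Ω × ℝ => ((p.1 : E), max p.2 0)) := by fun_prop
    exact hVc.comp_continuous this (fun p => ⟨p.1.2, Set.mem_Ici.2 (le_max_right _ _)⟩)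
  have h := (isCompact_univ (X := Ω × Ω)).continuous_sSup
    (f := fun (t : ℝ) (p : Ω × Ω) => ‖V p.1 (max t 0) - V p.2 (max t 0)‖) (by
      have h1 : Continuous (fun q : ℝ × (Ω × Ω) => V q.2.1 (max q.1 0)) :=
        hv.comp (g := fun p : Ω × ℝ => V p.1 (max p.2 0))
          (f := fun q : ℝ × (Ω × Ω) => (q.2.1, q.1)) (by fun_prop)
      have h2 : Continuous (fun q : ℝ × (Ω × Ω) => V q.2.2 (max q.1 0)) :=
        hv.comp (g := fun p : Ω × ℝ => V p.1 (max p.2 0))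
          (f := fun q : ℝ × (Ω × Ω) => (q.2.2, q.1)) (by fun_prop)
      exact (h1.sub h2).norm)
  convert h using 2 with t
  rw [hA]
  congr 1
  ext x
  constructor
  · rintro ⟨⟨a, b⟩, ⟨ha, hb⟩, rfl⟩
    exact ⟨(⟨a, ha⟩, ⟨b, hb⟩), trivial, rfl⟩
  · rintro ⟨⟨a, b⟩, -, rfl⟩
    exact ⟨(a, b), ⟨a.2, b.2⟩, rfl⟩

/-- The flocking estimate (e:flocking) for the Lagrangian formulation of the Euler Alignment
system with measure-valued density and heavy-tailed, radially decreasing kernel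
`φ(x) = Φ(|x|)`: the flock diameter `D(t)` stays bounded by some `D̄` and the velocity
amplitude decays like `A(t) ≤ A(0)·exp(−κ M₀ Φ(D̄) t)`. -/
theorem stmt_17 (n : ℕ) (hn : 1 ≤ n)
    (Ω : Set (EuclideanSpace ℝ (Fin n))) (hΩ : IsCompact Ω)
    (κ : ℝ) (hκ : 0 < κ)
    (m₀ : Measure (EuclideanSpace ℝ (Fin n))) [IsFiniteMeasure m₀]
    (hsupp : m₀ Ωᶜ = 0)
    (M₀ : ℝ) (hM₀ : 0 < M₀) (hmass : m₀ Set.univ = ENNReal.ofReal M₀)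
    (Φ : ℝ → ℝ) (hΦc : ContinuousOn Φ (Set.Ici 0))
    (hΦpos : ∀ r ≥ (0:ℝ), 0 < Φ r)
    (hΦmono : AntitoneOn Φ (Set.Ici 0))
    (hΦheavy : ∫⁻ r in Set.Ici (0:ℝ), ENNReal.ofReal (Φ r) = ⊤)
    (X V : EuclideanSpace ℝ (Fin n) → ℝ → EuclideanSpace ℝ (Fin n))
    (hXc : ContinuousOn (fun q : EuclideanSpace ℝ (Fin n) × ℝ => X q.1 q.2) (Ω ×ˢ Set.Ici 0))
    (hVc : ContinuousOn (fun q : EuclideanSpace ℝ (Fin n) × ℝ => V q.1 q.2) (Ω ×ˢ Set.Ici 0))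
    (hX0 : ∀ α ∈ Ω, X α 0 = α)
    (hXode : ∀ α ∈ Ω, ∀ t ≥ (0:ℝ), HasDerivWithinAt (X α) (V α t) (Set.Ici 0) t)
    (hVode : ∀ α ∈ Ω, ∀ t ≥ (0:ℝ), HasDerivWithinAt (V α)
      (-κ • ∫ γ in Ω, Φ ‖X α t - X γ t‖ • (V α t - V γ t) ∂m₀) (Set.Ici 0) t)
    (D A : ℝ → ℝ)
    (hD : ∀ t, D t = sSup ((fun q : EuclideanSpace ℝ (Fin n) × EuclideanSpace ℝ (Fin n) =>
      ‖X q.1 t - X q.2 t‖) '' (Ω ×ˢ Ω)))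
    (hA : ∀ t, A t = sSup ((fun q : EuclideanSpace ℝ (Fin n) × EuclideanSpace ℝ (Fin n) =>
      ‖V q.1 t - V q.2 t‖) '' (Ω ×ˢ Ω))) :
    ∃ Dbar : ℝ, (∀ t ≥ (0:ℝ), D t ≤ Dbar) ∧
      ∀ t ≥ (0:ℝ), A t ≤ A 0 * Real.exp (-κ * M₀ * Φ Dbar * t) := by
  classical
  have hΩm : MeasurableSet Ω := hΩ.isClosed.measurableSet
  have hmΩ : m₀ Ω = ENNReal.ofReal M₀ := by
    rw [← hmass, ← measure_add_measure_compl hΩm, hsupp, add_zero]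
  have hne : Ω.Nonempty := by
    rw [Set.nonempty_iff_ne_empty]
    rintro rfl
    rw [measure_empty] at hmΩ
    exact absurd (ENNReal.ofReal_eq_zero.1 hmΩ.symm) (not_le.2 hM₀)
  have hreal : m₀.real Ω = M₀ := by
    rw [Measure.real, hmΩ, ENNReal.toReal_ofReal hM₀.le]
  have slice : ∀ (W : EuclideanSpace ℝ (Fin n) → ℝ → EuclideanSpace ℝ (Fin n)),
      ContinuousOn (fun q : EuclideanSpace ℝ (Fin n) × ℝ => W q.1 q.2) (Ω ×ˢ Set.Ici 0) →
      ∀ t ≥ (0:ℝ), ContinuousOn (fun γ => W γ t) Ω := by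
    intro W hW t ht
    exact hW.comp (f := fun γ => (γ, t)) (by fun_prop) (fun γ hγ => ⟨hγ, ht⟩)
  have pairc : ∀ (W : EuclideanSpace ℝ (Fin n) → ℝ → EuclideanSpace ℝ (Fin n)),
      ContinuousOn (fun q : EuclideanSpace ℝ (Fin n) × ℝ => W q.1 q.2) (Ω ×ˢ Set.Ici 0) →
      ∀ t ≥ (0:ℝ), ContinuousOn (fun q : EuclideanSpace ℝ (Fin n) × EuclideanSpace ℝ (Fin n) =>
        ‖W q.1 t - W q.2 t‖) (Ω ×ˢ Ω) := by
    intro W hW t ht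
    have h1 : ContinuousOn (fun q : EuclideanSpace ℝ (Fin n) × EuclideanSpace ℝ (Fin n) =>
        W q.1 t) (Ω ×ˢ Ω) := (slice W hW t ht).comp continuousOn_fst (fun q hq => hq.1)
    have h2 : ContinuousOn (fun q : EuclideanSpace ℝ (Fin n) × EuclideanSpace ℝ (Fin n) =>
        W q.2 t) (Ω ×ˢ Ω) := (slice W hW t ht).comp continuousOn_snd (fun q hq => hq.2)
    exact (h1.sub h2).norm
  have leD : ∀ t ≥ (0:ℝ), ∀ α ∈ Ω, ∀ β ∈ Ω, ‖X α t - X β t‖ ≤ D t := by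
    intro t ht α hα β hβ
    rw [hD]
    exact le_csSup ((hΩ.prod hΩ).bddAbove_image (pairc X hXc t ht)) ⟨(α, β), ⟨hα, hβ⟩, rfl⟩
  have leA : ∀ t ≥ (0:ℝ), ∀ α ∈ Ω, ∀ β ∈ Ω, ‖V α t - V β t‖ ≤ A t := by
    intro t ht α hα β hβ
    rw [hA]
    exact le_csSup ((hΩ.prod hΩ).bddAbove_image (pairc V hVc t ht)) ⟨(α, β), ⟨hα, hβ⟩, rfl⟩
  obtain ⟨ω, hω⟩ := hne
  have Dnn : ∀ t ≥ (0:ℝ), 0 ≤ D t := fun t ht => (norm_nonneg _).trans (leD t ht ω hω ω hω)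
  have Ann : ∀ t ≥ (0:ℝ), 0 ≤ A t := fun t ht => (norm_nonneg _).trans (leA t ht ω hω ω hω)
  have key : ∀ t ≥ (0:ℝ), ∃ (f : ℝ → ℝ) (f' : ℝ), HasDerivWithinAt f f' (Set.Ici 0) t ∧
      f t = A t ∧ (∀ s ≥ (0:ℝ), f s ≤ A s) ∧ f' ≤ -κ * (M₀ * (Φ (D t) * A t)) := by
    intro t ht
    obtain ⟨⟨α, β⟩, ⟨hα, hβ⟩, hmx⟩ := (hΩ.prod hΩ).exists_sSup_image_eq
      ⟨(ω, ω), hω, hω⟩ (pairc V hVc t ht)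
    simp only at hα hβ hmx
    rw [← hA] at hmx
    set w := V α t - V β t with hw
    set l := (A t)⁻¹ • w with hl
    have hlw : inner ℝ l w = A t := by
      rw [hl, real_inner_smul_left, real_inner_self_eq_norm_sq, ← hmx]
      rcases eq_or_ne (A t) 0 with h | h
      · simp [h]
      · field_simp
    have hl1 : ‖l‖ ≤ 1 := by
      rw [hl, norm_smul, norm_inv, ← hmx, Real.norm_of_nonneg (Ann t ht)]
      exact inv_mul_le_one
    have hin : ∀ s ≥ (0:ℝ), ∀ a ∈ Ω, ∀ b ∈ Ω, inner ℝ l (V a s - V b s) ≤ A s := by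
      intro s hs a ha b hb
      calc inner ℝ l (V a s - V b s) ≤ ‖l‖ * ‖V a s - V b s‖ := real_inner_le_norm _ _
        _ ≤ 1 * ‖V a s - V b s‖ := by gcongr
        _ ≤ A s := by rw [one_mul]; exact leA s hs a ha b hb
    have hint : ∀ a ∈ Ω, IntegrableOn
        (fun γ => Φ ‖X a t - X γ t‖ • (V a t - V γ t)) Ω m₀ := by
      intro a ha
      apply ContinuousOn.integrableOn_compact hΩ
      have h1 : ContinuousOn (fun γ => ‖X a t - X γ t‖) Ω :=
        (continuousOn_const.sub (slice X hXc t ht)).norm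
      exact (hΦc.comp h1 (fun γ _ => norm_nonneg _)).smul
        (continuousOn_const.sub (slice V hVc t ht))
    refine ⟨fun s => inner ℝ l (V α s - V β s), _,
      ((innerSL ℝ l).hasFDerivAt.comp_hasDerivWithinAt t
        ((hVode α hα t ht).sub (hVode β hβ t ht))), hlw,
      fun s hs => hin s hs α hα β hβ, ?_⟩
    rw [← smul_sub, ← integral_sub (hint α hα) (hint β hβ), map_smul, smul_eq_mul]
    have hI : IntegrableOn (fun γ => Φ ‖X α t - X γ t‖ • (V α t - V γ t) -
        Φ ‖X β t - X γ t‖ • (V β t - V γ t)) Ω m₀ := (hint α hα).sub (hint β hβ)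
    rw [← (innerSL ℝ l).integral_comp_comm hI]
    have hge : M₀ * (Φ (D t) * A t) ≤ ∫ γ in Ω, (innerSL ℝ l)
        (Φ ‖X α t - X γ t‖ • (V α t - V γ t) - Φ ‖X β t - X γ t‖ • (V β t - V γ t)) ∂m₀ := by
      have hc : ∫ γ in Ω, (Φ (D t) * A t) ∂m₀ = M₀ * (Φ (D t) * A t) := by
        rw [setIntegral_const, hreal, smul_eq_mul]
      rw [← hc]
      apply setIntegral_mono_on (integrableOn_const (by finiteness))
        ((innerSL ℝ l).integrable_comp hI) hΩm
      intro γ hγ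
      have e1 : inner ℝ l (V α t - V γ t) + inner ℝ l (V γ t - V β t) = A t := by
        rw [← inner_add_right, sub_add_sub_cancel]; exact hlw
      have e2 : inner ℝ l (V β t - V γ t) = - inner ℝ l (V γ t - V β t) := by
        rw [← inner_neg_right, neg_sub]
      have p1 := hin t ht γ hγ β hβ
      have p2 := hin t ht α hα γ hγ
      have q1 : Φ (D t) ≤ Φ ‖X α t - X γ t‖ :=
        hΦmono (Set.mem_Ici.2 (norm_nonneg _)) (Dnn t ht) (leD t ht α hα γ hγ)
      have q2 : Φ (D t) ≤ Φ ‖X β t - X γ t‖ :=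
        hΦmono (Set.mem_Ici.2 (norm_nonneg _)) (Dnn t ht) (leD t ht β hβ γ hγ)
      simp only [map_sub, map_smul, smul_eq_mul]
      rw [← map_sub, ← map_sub, innerSL_apply_apply, innerSL_apply_apply, e2]
      generalize (inner ℝ l (V α t - V γ t) : ℝ) = a at *
      generalize (inner ℝ l (V γ t - V β t) : ℝ) = b at *
      rw [← e1, mul_add]
      linarith [mul_le_mul_of_nonneg_right q1 (by linarith : 0 ≤ a),
        mul_le_mul_of_nonneg_right q2 (by linarith : 0 ≤ b)]
    nlinarith [mul_le_mul_of_nonneg_left hge hκ.le]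
  have hAt : Continuous (fun t => A (max t 0)) := sup_cont_aux Ω hΩ V hVc A hA
  have hAc : ContinuousOn A (Set.Ici 0) := hAt.continuousOn.congr (fun t ht => by
    simp only [max_eq_left (Set.mem_Ici.1 ht)])
  set E : ℝ → ℝ := fun t => D 0 + ∫ s in (0:ℝ)..t, A (max s 0) with hE
  have hEd : ∀ t, HasDerivAt E (A (max t 0)) t := fun t =>
    ((hAt.integral_hasStrictDerivAt 0 t).hasDerivAt).const_add (D 0)
  have hDE : ∀ t ≥ (0:ℝ), D t ≤ E t := by
    intro t ht
    rw [hD]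
    have hn2 : (Ω ×ˢ Ω).Nonempty := ⟨(ω, ω), hω, hω⟩
    apply csSup_le (hn2.image _)
    rintro _ ⟨⟨α, β⟩, ⟨hα, hβ⟩, rfl⟩
    simp only at hα hβ ⊢
    have hd : ∀ s ≥ (0:ℝ), HasDerivWithinAt (fun s => X α s - X β s) (V α s - V β s)
        (Set.Ici 0) s := fun s hs => (hXode α hα s hs).sub (hXode β hβ s hs)
    refine image_norm_le_of_norm_deriv_right_le_deriv_boundary (a := 0) (b := t)
      (f := fun s => X α s - X β s) (f' := fun s => V α s - V β s) (B := E)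
      (B' := fun s => A (max s 0))
      (fun s hs => ((hd s hs.1).continuousWithinAt).mono (fun x hx => hx.1))
      (fun s hs => (hd s hs.1).mono (fun x hx => Set.mem_Ici.2 (hs.1.trans hx)))
      ?_ hEd ?_ ⟨ht, le_rfl⟩
    · simp only [hE, intervalIntegral.integral_same, add_zero]
      exact leD 0 le_rfl α hα β hβ
    · intro s hs
      simp only [max_eq_left hs.1]
      exact leA s hs.1 α hα β hβ
  have hΦt : Continuous (fun r => Φ (max r 0)) :=
    hΦc.comp_continuous (by fun_prop) (fun r => Set.mem_Ici.2 (le_max_right _ _))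
  set P : ℝ → ℝ := fun r => ∫ s in (0:ℝ)..r, Φ (max s 0) with hP
  have hPd : ∀ r, HasDerivAt P (Φ (max r 0)) r := fun r =>
    (hΦt.integral_hasStrictDerivAt 0 r).hasDerivAt
  have hPm : Monotone P := monotone_of_hasDerivAt_nonneg hPd
    (fun r => (hΦpos _ (le_max_right _ _)).le)
  have hE0 : E 0 = D 0 := by simp [hE]
  have hbound : ∀ t ≥ (0:ℝ), κ * M₀ * (P (E t) - P (D 0)) ≤ A 0 := by
    intro t ht
    have hε : ∀ ε > (0:ℝ), A t ≤ A 0 + ε * (1 + t) - κ * M₀ * (P (E t) - P (D 0)) := by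
      intro ε hε
      refine barrier_aux A (fun t => A 0 + ε * (1 + t) - κ * M₀ * (P (E t) - P (D 0)))
        (fun t => ε * 1 - κ * M₀ * (Φ (max (E t) 0) * A (max t 0)))
        (fun t => -κ * (M₀ * (Φ (D t) * A t))) hAc ?_ ?_ key ?_ t ht
      · intro s hs
        have h1 : HasDerivAt (fun t => P (E t)) (Φ (max (E s) 0) * A (max s 0)) s :=
          (hPd (E s)).comp s (hEd s)
        exact (((((hasDerivAt_id s).const_add 1).const_mul ε).const_add (A 0)).sub
          ((h1.sub_const (P (D 0))).const_mul (κ * M₀))).hasDerivWithinAt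
      · simp only [hE0]; linarith
      · intro s hs _
        have hEs : 0 ≤ E s := (Dnn s hs).trans (hDE s hs)
        simp only [max_eq_left (show (0:ℝ) ≤ s from hs), max_eq_left hEs]
        have h1 : Φ (E s) ≤ Φ (D s) := hΦmono (Dnn s hs) hEs (hDE s hs)
        have h2 : κ * M₀ * (Φ (E s) * A s) ≤ κ * M₀ * (Φ (D s) * A s) := by
          have := Ann s hs
          gcongr
        linarith
    have h3 : A t ≤ A 0 - κ * M₀ * (P (E t) - P (D 0)) := by
      apply le_of_forall_pos_le_add
      intro δ hδ
      have h4 := hε (δ / (1 + t)) (by positivity)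
      rw [div_mul_cancel₀ _ (by positivity)] at h4
      linarith
    linarith [Ann t ht]
  have hunb : ∀ C : ℝ, ∃ R ≥ (0:ℝ), C < P R := by
    intro C
    by_contra! hcon
    have hi : IntegrableOn (fun r => Φ (max r 0)) (Set.Ioi 0) := by
      refine integrableOn_Ioi_of_intervalIntegral_norm_bounded (l := Filter.atTop) (b := id) C 0
        (fun i => (hΦt.integrableOn_Icc).mono_set Set.Ioc_subset_Icc_self) Filter.tendsto_id ?_
      filter_upwards [Filter.eventually_ge_atTop (0:ℝ)] with R hR
      have := hcon R hR
      simp only [hP] at this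
      simpa only [Real.norm_of_nonneg (hΦpos _ (le_max_right _ _)).le, id_eq] using this
    have h1 := hi.lintegral_lt_top
    rw [← setLIntegral_congr (Ioi_ae_eq_Ici (a := (0:ℝ)) (μ := volume))] at hΦheavy
    rw [setLIntegral_congr_fun (g := fun r => ENNReal.ofReal (Φ r)) measurableSet_Ioi
      (fun r (hr : 0 < r) => by simp only [max_eq_left hr.le]), hΦheavy] at h1
    exact lt_irrefl _ h1
  obtain ⟨R, hR0, hR⟩ := hunb (P (D 0) + A 0 / (κ * M₀))
  have hDR : ∀ t ≥ (0:ℝ), D t ≤ R := by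
    intro t ht
    refine (hDE t ht).trans ?_
    by_contra! h
    have h1 := hPm h.le
    have h2 := hbound t ht
    rw [← le_div_iff₀' (by positivity)] at h2
    linarith
  refine ⟨R, hDR, ?_⟩
  intro t ht
  have hε : ∀ ε > (0:ℝ), A t ≤ (A 0 + ε) * Real.exp ((-κ * M₀ * Φ R + ε) * t) := by
    intro ε hε
    refine barrier_aux A (fun t => (A 0 + ε) * Real.exp ((-κ * M₀ * Φ R + ε) * t))
      (fun t => (A 0 + ε) * (Real.exp ((-κ * M₀ * Φ R + ε) * t) *
        ((-κ * M₀ * Φ R + ε) * 1)))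
      (fun t => -κ * (M₀ * (Φ (D t) * A t))) hAc ?_ ?_ key ?_ t ht
    · intro s hs
      exact ((((hasDerivAt_id s).const_mul (-κ * M₀ * Φ R + ε)).exp).const_mul
        (A 0 + ε)).hasDerivWithinAt
    · simp [hε]
    · intro s hs heq
      have hA0 := Ann 0 le_rfl
      have hBp : 0 < (A 0 + ε) * Real.exp ((-κ * M₀ * Φ R + ε) * s) := by positivity
      have h1 : Φ R ≤ Φ (D s) := hΦmono (Dnn s hs) hR0 (hDR s hs)
      rw [← heq] at hBp
      have h2 : κ * M₀ * (Φ R * A s) ≤ κ * M₀ * (Φ (D s) * A s) := by gcongr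
      have h3 : (A 0 + ε) * (Real.exp ((-κ * M₀ * Φ R + ε) * s) *
        ((-κ * M₀ * Φ R + ε) * 1)) = A s * (-κ * M₀ * Φ R + ε) := by rw [heq]; ring
      rw [h3]
      nlinarith [mul_pos hBp hε]
  have hcont : Continuous (fun ε : ℝ => (A 0 + ε) * Real.exp ((-κ * M₀ * Φ R + ε) * t)) := by
    fun_prop
  have hlim := (hcont.tendsto 0).mono_left (nhdsWithin_le_nhds (s := Set.Ioi 0))
  simp only [add_zero] at hlim
  refine ge_of_tendsto hlim ?_
  filter_upwards [self_mem_nhdsWithin] with ε h using hε ε h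
end

section
/- Let a, b > 0 and let x, v : [0,∞) → [0,∞) be differentiable functions satisfying x′(t) ≤ v(t) and v′(t) ≤ a·e^{−bt}·x(t) − b·v(t) for all t ≥ 0. Then for every t ≥ 0: a·x(t)² + e^{bt}·v(t)² ≤ exp(4√a/b)·(a·x(0)² + v(0)²). Consequently, x(t) ≤ exp(2√a/b)·√(x(0)² + v(0)²/a) and v(t) ≤ exp(2√a/b)·e^{−bt/2}·√(a·x(0)² + v(0)²) for all t ≥ 0. -/
theorem le_of_sq_le_sq_aux {p q : ℝ} (h : p ^ 2 ≤ q ^ 2) (hq : 0 ≤ q) : p ≤ q :=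
  abs_le_of_sq_le_sq' h hq |>.2

/-- The Grönwall-type lemma for the system (e:system(x,v)): if `x′ ≤ v` and
`v′ ≤ a·e^{−bt}·x − b·v` with `x, v ≥ 0`, then `a·x(t)² + e^{bt}·v(t)²` stays bounded by
`exp(4√a/b)·(a·x(0)² + v(0)²)`, and consequently `x` is bounded and `v` decays like
`e^{−bt/2}`. -/
theorem stmt_18 (a b : ℝ) (ha : 0 < a) (hb : 0 < b)
    (x v x' v' : ℝ → ℝ)
    (hx0 : ∀ t ≥ (0:ℝ), 0 ≤ x t) (hv0 : ∀ t ≥ (0:ℝ), 0 ≤ v t)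
    (hxd : ∀ t ≥ (0:ℝ), HasDerivWithinAt x (x' t) (Set.Ici 0) t)
    (hvd : ∀ t ≥ (0:ℝ), HasDerivWithinAt v (v' t) (Set.Ici 0) t)
    (hxineq : ∀ t ≥ (0:ℝ), x' t ≤ v t)
    (hvineq : ∀ t ≥ (0:ℝ), v' t ≤ a * Real.exp (-b * t) * x t - b * v t) :
    ∀ t ≥ (0:ℝ),
      a * x t ^ 2 + Real.exp (b * t) * v t ^ 2 ≤
        Real.exp (4 * Real.sqrt a / b) * (a * x 0 ^ 2 + v 0 ^ 2) ∧
      x t ≤ Real.exp (2 * Real.sqrt a / b) * Real.sqrt (x 0 ^ 2 + v 0 ^ 2 / a) ∧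
      v t ≤ Real.exp (2 * Real.sqrt a / b) * Real.exp (-b * t / 2) *
        Real.sqrt (a * x 0 ^ 2 + v 0 ^ 2) := by
  have hs : 0 < Real.sqrt a := Real.sqrt_pos.2 ha
  have hsa : Real.sqrt a ^ 2 = a := Real.sq_sqrt ha.le
  set s := Real.sqrt a with hsdef
  have hder : ∀ t ≥ (0:ℝ), HasDerivWithinAt
      (fun t => (a * x t ^ 2 + Real.exp (b * t) * v t ^ 2) *
        Real.exp (4 * s / b * Real.exp (-(b / 2) * t)))
      ((a * (2 * x t * x' t) + (Real.exp (b * t) * b * v t ^ 2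
          + Real.exp (b * t) * (2 * v t * v' t))) *
        Real.exp (4 * s / b * Real.exp (-(b / 2) * t)) +
        (a * x t ^ 2 + Real.exp (b * t) * v t ^ 2) *
        (Real.exp (4 * s / b * Real.exp (-(b / 2) * t)) *
          (4 * s / b * (Real.exp (-(b / 2) * t) * (-(b / 2)))))) (Set.Ici 0) t := by
    intro t ht
    have hl : ∀ c : ℝ, HasDerivWithinAt (fun t => Real.exp (c * t))
        (Real.exp (c * t) * c) (Set.Ici 0) t := by
      intro c
      have h1 : HasDerivAt (fun t : ℝ => c * t) c t := by
        simpa using (hasDerivAt_id t).const_mul c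
      exact h1.exp.hasDerivWithinAt
    have h1 : HasDerivWithinAt (fun t => x t ^ 2) (2 * x t * x' t) (Set.Ici 0) t := by
      simpa using (hxd t ht).fun_pow 2
    have h2 : HasDerivWithinAt (fun t => v t ^ 2) (2 * v t * v' t) (Set.Ici 0) t := by
      simpa using (hvd t ht).fun_pow 2
    exact ((h1.const_mul a).fun_add ((hl b).fun_mul h2)).fun_mul
      (((hl (-(b / 2))).const_mul (4 * s / b)).exp)
  have hanti := antitoneOn_of_hasDerivWithinAt_nonpos (convex_Ici (0:ℝ))
    (fun t ht => (hder t ht).continuousWithinAt)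
    (fun t ht => (hder t (interior_subset ht)).mono interior_subset)
    (by
      intro t ht
      have ht : 0 ≤ t := interior_subset ht
      have hx := hx0 t ht
      have hv := hv0 t ht
      have hxi := hxineq t ht
      have hvi := hvineq t ht
      have e1 : Real.exp (b * t) = Real.exp (b / 2 * t) ^ 2 := by
        rw [← Real.exp_nat_mul]; congr 1; push_cast; ring
      have e2 : Real.exp (-(b / 2) * t) = (Real.exp (b / 2 * t))⁻¹ := by
        rw [← Real.exp_neg]; congr 1; ring
      have e3 : Real.exp (-b * t) = (Real.exp (b / 2 * t) ^ 2)⁻¹ := by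
        rw [← e1, ← Real.exp_neg]; congr 1; ring
      rw [e3] at hvi
      set K := Real.exp (4 * s / b * Real.exp (-(b / 2) * t))
      have hK : 0 < K := Real.exp_pos _
      rw [e1, e2]
      have hq : 0 < Real.exp (b / 2 * t) := Real.exp_pos _
      set q := Real.exp (b / 2 * t)
      have k1 : a * (2 * x t * x' t) ≤ 2 * a * x t * v t := by
        have := mul_le_mul_of_nonneg_left hxi (by positivity : 0 ≤ 2 * a * x t)
        linarith
      have k2 : q ^ 2 * (2 * v t * v' t) ≤ 2 * a * x t * v t - 2 * b * (q ^ 2 * v t ^ 2) := by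
        have := mul_le_mul_of_nonneg_left hvi (by positivity : 0 ≤ q ^ 2 * (2 * v t))
        have h : q ^ 2 * (2 * v t) * (a * (q ^ 2)⁻¹ * x t - b * v t)
          = 2 * a * x t * v t - 2 * b * (q ^ 2 * v t ^ 2) := by
          field_simp
        linarith
      have k3 : 4 * a * x t * v t ≤ 2 * s * q⁻¹ * (a * x t ^ 2 + q ^ 2 * v t ^ 2) := by
        have h : 2 * s * q⁻¹ * (a * x t ^ 2 + q ^ 2 * v t ^ 2) - 4 * a * x t * v t
          = 2 * s * q⁻¹ * (s * x t - q * v t) ^ 2 := by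
          rw [← hsa]; field_simp; ring
        have : 0 ≤ 2 * s * q⁻¹ * (s * x t - q * v t) ^ 2 := by positivity
        linarith
      have k4 : 0 ≤ b * (q ^ 2 * v t ^ 2) := by positivity
      have k5 : 4 * s / b * (q⁻¹ * (-(b / 2))) = - (2 * s * q⁻¹) := by
        field_simp; ring
      rw [k5]
      have : K * (a * (2 * x t * x' t) + (q ^ 2 * b * v t ^ 2 + q ^ 2 * (2 * v t * v' t))
        - 2 * s * q⁻¹ * (a * x t ^ 2 + q ^ 2 * v t ^ 2)) ≤ 0 := by
        apply mul_nonpos_of_nonneg_of_nonpos hK.le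
        linarith
      linarith)
  intro t ht
  have hE0 : 0 ≤ a * x 0 ^ 2 + v 0 ^ 2 := by positivity
  have main : a * x t ^ 2 + Real.exp (b * t) * v t ^ 2 ≤
        Real.exp (4 * s / b) * (a * x 0 ^ 2 + v 0 ^ 2) := by
    have h := hanti (Set.mem_Ici.2 le_rfl) (Set.mem_Ici.2 ht) ht
    simp only [mul_zero, Real.exp_zero, mul_one, one_mul] at h
    have h1 : 1 ≤ Real.exp (4 * s / b * Real.exp (-(b / 2) * t)) :=
      Real.one_le_exp (by positivity)
    have h2 := le_mul_of_one_le_right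
      (by positivity : 0 ≤ a * x t ^ 2 + Real.exp (b * t) * v t ^ 2) h1
    linarith
  have e4 : Real.exp (4 * s / b) = Real.exp (2 * s / b) ^ 2 := by
    rw [← Real.exp_nat_mul]; congr 1; push_cast; ring
  refine ⟨main, ?_, ?_⟩
  · refine le_of_sq_le_sq_aux ?_ (by positivity)
    rw [mul_pow, Real.sq_sqrt (by positivity), ← e4]
    have h : a * (Real.exp (4 * s / b) * (x 0 ^ 2 + v 0 ^ 2 / a))
      = Real.exp (4 * s / b) * (a * x 0 ^ 2 + v 0 ^ 2) := by field_simp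
    have : 0 ≤ Real.exp (b * t) * v t ^ 2 := by positivity
    refine le_of_mul_le_mul_left ?_ ha
    linarith
  · refine le_of_sq_le_sq_aux ?_ (by positivity)
    rw [mul_pow, mul_pow, Real.sq_sqrt hE0, ← e4]
    have e5 : Real.exp (-b * t / 2) ^ 2 = (Real.exp (b * t))⁻¹ := by
      rw [← Real.exp_nat_mul, ← Real.exp_neg]; congr 1; push_cast; ring
    rw [e5]
    have hp := Real.exp_pos (b * t)
    have h : Real.exp (b * t) * (Real.exp (4 * s / b) * (Real.exp (b * t))⁻¹ *
      (a * x 0 ^ 2 + v 0 ^ 2)) = Real.exp (4 * s / b) * (a * x 0 ^ 2 + v 0 ^ 2) := by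
      field_simp
    have : 0 ≤ a * x t ^ 2 := by positivity
    refine le_of_mul_le_mul_left ?_ hp
    linarith
end
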